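/- arXiv:2412.20609 — 9 statements merged into one kernel-verified Lean document; each statement's English description precedes it below -/
import Mathlib

section
/- Let S be a reduced proper subset of the Lipschitz quaternions L with |S| ≥ 2. Then S is a ringset of L if and only if one of the following holds: Γ(S) = 2; or Γ(S) = 4; or Γ(S) = 8 and there exist δ₁, δ₂ ∈ Δ(S) that are congruent modulo 4 (i.e., the difference lies in 4L) to two distinct elements of {2i+2j, 2i+2k, 2j+2k}. -/
noncomputable section

open Polynomial

abbrev 𝔻 : Type := Quaternion ℚ

def qi : 𝔻 := QuaternionAlgebra.mk 0 1 0 0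
def qj : 𝔻 := QuaternionAlgebra.mk 0 0 1 0
def qk : 𝔻 := QuaternionAlgebra.mk 0 0 0 1

def isIntQ (q : ℚ) : Prop := ∃ z : ℤ, q = (z : ℚ)
def isHalfOddQ (q : ℚ) : Prop := ∃ z : ℤ, q = (z : ℚ) + 1/2

def Lip : Set 𝔻 :=
  {α | isIntQ α.re ∧ isIntQ α.imI ∧ isIntQ α.imJ ∧ isIntQ α.imK}

def HurOff : Set 𝔻 :=
  {α | isHalfOddQ α.re ∧ isHalfOddQ α.imI ∧ isHalfOddQ α.imJ ∧ isHalfOddQ α.imK}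

def Hur : Set 𝔻 := Lip ∪ HurOff

def qnorm (α : 𝔻) : ℚ := α.re ^ 2 + α.imI ^ 2 + α.imJ ^ 2 + α.imK ^ 2

def minPoly (α : 𝔻) : Polynomial ℚ :=
  if α.imI = 0 ∧ α.imJ = 0 ∧ α.imK = 0 then X - C α.re
  else X ^ 2 - C (2 * α.re) * X + C (qnorm α)

def classOf (R : Set 𝔻) (m : Polynomial ℤ) : Set 𝔻 :=
  {α | α ∈ R ∧ minPoly α = m.map (Int.castRingHom ℚ)}

def IntPolys (S R : Set 𝔻) : Set (Polynomial 𝔻) :=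
  {f | ∀ α ∈ S, f.eval α ∈ R}

def IsRingset (S R : Set 𝔻) : Prop :=
  ∀ f ∈ IntPolys S R, ∀ g ∈ IntPolys S R, f * g ∈ IntPolys S R

def transSet (S : Set 𝔻) (a : ℤ) : Set 𝔻 := (fun α => α + (a : 𝔻)) '' S

def scaleSet (n : ℤ) (R : Set 𝔻) : Set 𝔻 := (fun α => (n : 𝔻) * α) '' R

def IsReducedIn (S R : Set 𝔻) : Prop :=
  (∃ m : Polynomial ℤ, m.Monic ∧ m.natDegree = 2 ∧ S ⊆ classOf R m) ∧
  (∀ a n : ℤ, 2 ≤ n → ¬ (transSet S a ⊆ scaleSet n R))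

def diffs (S : Set 𝔻) : Set 𝔻 := {δ | ∃ α ∈ S, ∃ β ∈ S, δ = α - β}

def normsOf (S : Set 𝔻) : Set ℤ := {n : ℤ | ∃ δ ∈ diffs S, (n : ℚ) = qnorm δ}

def gam (S : Set 𝔻) : ℕ := sSup {g : ℕ | ∀ t ∈ normsOf S, (g : ℤ) ∣ t}

def starSet (S R : Set 𝔻) : Set 𝔻 :=
  {β | ∃ α ∈ S, ∃ u v : 𝔻, u ∈ R ∧ v ∈ R ∧ u * v = 1 ∧ v * u = 1 ∧ β = u * α * v}

def idealGen (R : Set 𝔻) (x : 𝔻) : Set 𝔻 :=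
  {β | ∃ n : ℕ, ∃ a b : Fin n → 𝔻, (∀ k, a k ∈ R) ∧ (∀ k, b k ∈ R) ∧ β = ∑ k, a k * x * b k}

/-- The quaternion with the given integer coordinates. -/
def lq (a b c d : ℤ) : 𝔻 := ⟨a, b, c, d⟩

@[simp] lemma re_lq (a b c d : ℤ) : (lq a b c d).re = a := rfl
@[simp] lemma imI_lq (a b c d : ℤ) : (lq a b c d).imI = b := rfl
@[simp] lemma imJ_lq (a b c d : ℤ) : (lq a b c d).imJ = c := rfl
@[simp] lemma imK_lq (a b c d : ℤ) : (lq a b c d).imK = d := rfl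

lemma mem_Lip_iff {α : 𝔻} : α ∈ Lip ↔ ∃ a b c d : ℤ, α = lq a b c d := by
  constructor
  · rintro ⟨⟨a, ha⟩, ⟨b, hb⟩, ⟨c, hc⟩, ⟨d, hd⟩⟩
    exact ⟨a, b, c, d, by ext <;> simp [*]⟩
  · rintro ⟨a, b, c, d, rfl⟩
    exact ⟨⟨a, rfl⟩, ⟨b, rfl⟩, ⟨c, rfl⟩, ⟨d, rfl⟩⟩

lemma lq_mem (a b c d : ℤ) : lq a b c d ∈ Lip := mem_Lip_iff.2 ⟨a, b, c, d, rfl⟩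

lemma lq_add (a b c d a' b' c' d' : ℤ) :
    lq a b c d + lq a' b' c' d' = lq (a + a') (b + b') (c + c') (d + d') := by
  ext <;> simp

lemma lq_sub (a b c d a' b' c' d' : ℤ) :
    lq a b c d - lq a' b' c' d' = lq (a - a') (b - b') (c - c') (d - d') := by
  ext <;> simp

lemma lq_mul (a b c d a' b' c' d' : ℤ) :
    lq a b c d * lq a' b' c' d' =
      lq (a * a' - b * b' - c * c' - d * d') (a * b' + b * a' + c * d' - d * c')
        (a * c' - b * d' + c * a' + d * b') (a * d' + b * c' - c * b' + d * a') := by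
  ext <;> simp

lemma intCast_eq_lq (n : ℤ) : (n : 𝔻) = lq n 0 0 0 := by
  ext <;> simp

lemma lq_inj {a b c d a' b' c' d' : ℤ} :
    lq a b c d = lq a' b' c' d' ↔ a = a' ∧ b = b' ∧ c = c' ∧ d = d' := by
  simp [Quaternion.ext_iff]

lemma qnorm_lq (a b c d : ℤ) : qnorm (lq a b c d) = ((a ^ 2 + b ^ 2 + c ^ 2 + d ^ 2 : ℤ) : ℚ) := by
  simp [qnorm]

lemma lip_add {x y : 𝔻} (hx : x ∈ Lip) (hy : y ∈ Lip) : x + y ∈ Lip := by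
  obtain ⟨a, b, c, d, rfl⟩ := mem_Lip_iff.1 hx
  obtain ⟨a', b', c', d', rfl⟩ := mem_Lip_iff.1 hy
  rw [lq_add]; exact lq_mem ..

lemma lip_sub {x y : 𝔻} (hx : x ∈ Lip) (hy : y ∈ Lip) : x - y ∈ Lip := by
  obtain ⟨a, b, c, d, rfl⟩ := mem_Lip_iff.1 hx
  obtain ⟨a', b', c', d', rfl⟩ := mem_Lip_iff.1 hy
  rw [lq_sub]; exact lq_mem ..

lemma lip_mul {x y : 𝔻} (hx : x ∈ Lip) (hy : y ∈ Lip) : x * y ∈ Lip := by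
  obtain ⟨a, b, c, d, rfl⟩ := mem_Lip_iff.1 hx
  obtain ⟨a', b', c', d', rfl⟩ := mem_Lip_iff.1 hy
  rw [lq_mul]; exact lq_mem ..

lemma isIntQ_inv_mul {n : ℤ} (hn : n ≠ 0) (a : ℤ) : isIntQ ((n : ℚ)⁻¹ * a) ↔ n ∣ a := by
  have hn' : (n : ℚ) ≠ 0 := by exact_mod_cast hn
  constructor
  · rintro ⟨z, hz⟩
    refine ⟨z, ?_⟩
    have : (a : ℚ) = n * z := by rw [← hz]; field_simp
    exact_mod_cast this
  · rintro ⟨z, rfl⟩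
    exact ⟨z, by push_cast; field_simp⟩

lemma smul_lq_mem {n : ℤ} (hn : n ≠ 0) (a b c d : ℤ) :
    (n : ℚ)⁻¹ • lq a b c d ∈ Lip ↔ n ∣ a ∧ n ∣ b ∧ n ∣ c ∧ n ∣ d := by
  simp only [Lip, Set.mem_ofPred_eq, Quaternion.re_smul, Quaternion.imI_smul,
    Quaternion.imJ_smul, Quaternion.imK_smul, re_lq, imI_lq, imJ_lq, imK_lq, smul_eq_mul,
    isIntQ_inv_mul hn]

lemma mem_scaleSet_iff {n : ℤ} {a b c d : ℤ} :
    lq a b c d ∈ scaleSet n Lip ↔ n ∣ a ∧ n ∣ b ∧ n ∣ c ∧ n ∣ d := by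
  constructor
  · rintro ⟨x, hx, h⟩
    obtain ⟨a', b', c', d', rfl⟩ := mem_Lip_iff.1 hx
    simp only [intCast_eq_lq, lq_mul, lq_inj] at h
    obtain ⟨rfl, rfl, rfl, rfl⟩ := h
    simp
  · rintro ⟨⟨a, rfl⟩, ⟨b, rfl⟩, ⟨c, rfl⟩, ⟨d, rfl⟩⟩
    refine ⟨lq a b c d, lq_mem .., ?_⟩
    simp [intCast_eq_lq, lq_mul]

/-- A polynomial acts on a set of roots of a common central quadratic like a linear one. -/
lemma exists_linear {S : Set 𝔻} {t n : ℚ} (hS : ∀ α ∈ S, α * α = t • α + n • 1)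
    (f : Polynomial 𝔻) :
    ∃ a b : 𝔻, ∀ α ∈ S, f.eval α = a * α + b ∧
      ∀ g : Polynomial 𝔻, (f * g).eval α = a * g.eval α * α + b * g.eval α := by
  induction f using Polynomial.induction_on' with
  | add p q hp hq =>
    obtain ⟨a, b, h⟩ := hp
    obtain ⟨a', b', h'⟩ := hq
    refine ⟨a + a', b + b', fun α hα => ⟨?_, fun g => ?_⟩⟩
    · rw [eval_add, (h α hα).1, (h' α hα).1]; noncomm_ring
    · rw [add_mul, eval_add, (h α hα).2, (h' α hα).2]; noncomm_ring
  | monomial k c =>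
    have hpow : ∃ u v : ℚ, ∀ α ∈ S, α ^ k = u • α + v • 1 := by
      induction k with
      | zero => exact ⟨0, 1, fun α _ => by simp⟩
      | succ k ih =>
        obtain ⟨u, v, h⟩ := ih
        refine ⟨u * t + v, u * n, fun α hα => ?_⟩
        rw [pow_succ, h α hα, add_mul, smul_mul_assoc, hS α hα]
        simp only [smul_mul_assoc, one_mul]
        module
    obtain ⟨u, v, h⟩ := hpow
    refine ⟨u • c, v • c, fun α hα => ⟨?_, fun g => ?_⟩⟩
    · rw [eval_monomial, h α hα]; simp only [mul_add, mul_smul_comm, smul_mul_assoc, mul_one]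
    · have : (monomial k c * g).eval α = c * (g.eval α * α ^ k) := by
        rw [← C_mul_X_pow_eq_monomial, mul_assoc, eval_C_mul, X_pow_mul, eval_mul_X_pow]
      rw [this, h α hα]; simp only [mul_add, mul_smul_comm, smul_mul_assoc, mul_one, mul_assoc]

lemma isRingset_iff {S : Set 𝔻} {t n : ℚ} (hS : ∀ α ∈ S, α * α = t • α + n • 1) :
    IsRingset S Lip ↔ ∀ a : 𝔻, (∀ δ ∈ diffs S, a * δ ∈ Lip) →
      ∀ α ∈ S, ∀ γ ∈ Lip, a * (γ * α - α * γ) ∈ Lip := by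
  constructor
  · intro h a ha α hα γ hγ
    have h1 := h (C a * X - C (a * α)) (fun β hβ => by
      have := ha (β - α) ⟨β, hβ, α, hα, rfl⟩
      simpa [mul_sub] using this) (C γ) (fun β _ => by simpa using hγ) α hα
    have h2 : (C a * X - C (a * α)) * C γ = C (a * γ) * X - C (a * α * γ) := by
      simp only [sub_mul, C_mul, mul_assoc, X_mul_C]
    rw [h2] at h1
    simpa [mul_sub, mul_assoc] using h1
  · intro h f hf g hg α hα
    obtain ⟨a, b, hab⟩ := exists_linear hS f
    have hγ := hg α hα
    rw [(hab α hα).2]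
    have h1 := h a (by
      rintro δ ⟨β, hβ, β', hβ', rfl⟩
      have := lip_sub (hf β hβ) (hf β' hβ')
      rw [(hab β hβ).1, (hab β' hβ').1] at this
      convert this using 1
      noncomm_ring) α hα _ hγ
    have h2 := hf α hα
    rw [(hab α hα).1] at h2
    convert lip_add h1 (lip_mul h2 hγ) using 1
    noncomm_ring

lemma coords_of_reduced {S : Set 𝔻} (hred : IsReducedIn S Lip) (hne : S.Nonempty) :
    ∃ r N : ℤ, ∀ α ∈ S, ∃ x y z : ℤ, α = lq r x y z ∧ x ^ 2 + y ^ 2 + z ^ 2 = N := by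
  obtain ⟨⟨m, hm, hdeg, hS⟩, -⟩ := hred
  have key : ∀ α ∈ S, α ∈ Lip ∧ -(2 * α.re) = m.coeff 1 ∧ qnorm α = m.coeff 0 := by
    intro α hα
    obtain ⟨hL, hmin⟩ := hS hα
    have hd : (m.map (Int.castRingHom ℚ)).natDegree = 2 := by rw [hm.natDegree_map, hdeg]
    unfold minPoly at hmin
    split_ifs at hmin with h0
    · rw [← hmin, natDegree_X_sub_C] at hd; omega
    · have h1 := congrArg (fun p => p.coeff 1) hmin
      have h2 := congrArg (fun p => p.coeff 0) hmin
      simp [coeff_X, coeff_C] at h1 h2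
      exact ⟨hL, by simpa using h1, h2⟩
  obtain ⟨α₀, h₀⟩ := hne
  obtain ⟨hL, h1, h2⟩ := key α₀ h₀
  obtain ⟨r, x₀, y₀, z₀, rfl⟩ := mem_Lip_iff.1 hL
  refine ⟨r, x₀ ^ 2 + y₀ ^ 2 + z₀ ^ 2, fun α hα => ?_⟩
  obtain ⟨hL', h1', h2'⟩ := key α hα
  obtain ⟨r', x, y, z, rfl⟩ := mem_Lip_iff.1 hL'
  have hr : r' = r := by
    have : (r' : ℚ) = r := by
      have := h1.trans h1'.symm
      simp only [re_lq] at this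
      linarith
    exact_mod_cast this
  subst hr
  refine ⟨x, y, z, rfl, ?_⟩
  have := h2'.trans h2.symm
  rw [qnorm_lq, qnorm_lq] at this
  have : r' ^ 2 + x ^ 2 + y ^ 2 + z ^ 2 = r' ^ 2 + x₀ ^ 2 + y₀ ^ 2 + z₀ ^ 2 := by
    exact_mod_cast this
  linarith

/-- Reducedness: no integer `≥ 2` divides all imaginary coordinates. -/
lemma exists_not_dvd {S : Set 𝔻} (hred : IsReducedIn S Lip) {r N : ℤ}
    (hS : ∀ α ∈ S, ∃ x y z : ℤ, α = lq r x y z ∧ x ^ 2 + y ^ 2 + z ^ 2 = N) {n : ℤ} (hn : 2 ≤ n) :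
    ∃ x y z : ℤ, lq r x y z ∈ S ∧ ¬ (n ∣ x ∧ n ∣ y ∧ n ∣ z) := by
  by_contra! hcon
  refine hred.2 (-r) n hn ?_
  rintro _ ⟨α, hα, rfl⟩
  obtain ⟨x, y, z, rfl, -⟩ := hS α hα
  simp only [intCast_eq_lq, lq_add, mem_scaleSet_iff]
  simpa using hcon x y z hα

lemma gam_spec {S : Set 𝔻} (hS : S ⊆ Lip) (hcard : S.Nontrivial) :
    0 < gam S ∧ (∀ t ∈ normsOf S, (gam S : ℤ) ∣ t) ∧
      ∀ g : ℕ, (∀ t ∈ normsOf S, (g : ℤ) ∣ t) → g ∣ gam S := by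
  obtain ⟨α, hα, β, hβ, hne⟩ := hcard
  obtain ⟨a, b, c, d, h⟩ := mem_Lip_iff.1 (lip_sub (hS hα) (hS hβ))
  set n := a ^ 2 + b ^ 2 + c ^ 2 + d ^ 2 with hn
  have hmem : n ∈ normsOf S := ⟨α - β, ⟨α, hα, β, hβ, rfl⟩, by rw [h, qnorm_lq]⟩
  have hpos : 0 < n := by
    by_contra! hle
    have ha : a = 0 := by nlinarith [sq_nonneg a, sq_nonneg b, sq_nonneg c, sq_nonneg d]
    have hb : b = 0 := by nlinarith [sq_nonneg a, sq_nonneg b, sq_nonneg c, sq_nonneg d]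
    have hc : c = 0 := by nlinarith [sq_nonneg a, sq_nonneg b, sq_nonneg c, sq_nonneg d]
    have hd : d = 0 := by nlinarith [sq_nonneg a, sq_nonneg b, sq_nonneg c, sq_nonneg d]
    subst ha hb hc hd
    exact hne (sub_eq_zero.1 (by rw [h, ← intCast_eq_lq, Int.cast_zero]))
  have hbdd : BddAbove {g : ℕ | ∀ t ∈ normsOf S, (g : ℤ) ∣ t} :=
    ⟨n.toNat, fun g hg => by have := Int.le_of_dvd hpos (hg n hmem); omega⟩
  have hgam : ∀ t ∈ normsOf S, (gam S : ℤ) ∣ t :=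
    Nat.sSup_mem ⟨1, fun t _ => by simp⟩ hbdd
  have hgpos : 0 < gam S := by
    rcases Nat.eq_zero_or_pos (gam S) with h0 | h0
    · have := hgam n hmem
      rw [h0, Nat.cast_zero, zero_dvd_iff] at this
      omega
    · exact h0
  refine ⟨hgpos, hgam, fun g hg => ?_⟩
  have hl : Nat.lcm g (gam S) ≤ gam S := le_csSup hbdd fun t ht => by
    exact Int.coe_lcm_dvd (hg t ht) (hgam t ht)
  have := Nat.le_antisymm hl (Nat.le_of_dvd (Nat.lcm_pos (Nat.pos_of_ne_zero (by
    rintro rfl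
    have := hg n hmem
    simp at this; omega)) hgpos) (Nat.dvd_lcm_right g (gam S)))
  rw [← this]; exact Nat.dvd_lcm_left g (gam S)

/-- `n` divides the product `(a₀ + a₁ i + a₂ j + a₃ k) (x i + y j + z k)`. -/
def DvdMul (n a₀ a₁ a₂ a₃ x y z : ℤ) : Prop :=
  n ∣ a₁ * x + a₂ * y + a₃ * z ∧ n ∣ a₀ * x + a₂ * z - a₃ * y ∧
    n ∣ a₀ * y + a₃ * x - a₁ * z ∧ n ∣ a₀ * z + a₁ * y - a₂ * x

lemma smul_mul_mem_iff {n : ℤ} (hn : n ≠ 0) (a₀ a₁ a₂ a₃ x y z : ℤ) :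
    (n : ℚ)⁻¹ • lq a₀ a₁ a₂ a₃ * lq 0 x y z ∈ Lip ↔ DvdMul n a₀ a₁ a₂ a₃ x y z := by
  rw [smul_mul_assoc, lq_mul, smul_lq_mem hn, DvdMul, ← dvd_neg (b := a₁ * x + a₂ * y + a₃ * z)]
  ring_nf

lemma commutator_lq (r x y z g₀ g₁ g₂ g₃ : ℤ) :
    lq g₀ g₁ g₂ g₃ * lq r x y z - lq r x y z * lq g₀ g₁ g₂ g₃ =
      lq 0 (2 * (g₂ * z - g₃ * y)) (2 * (g₃ * x - g₁ * z)) (2 * (g₁ * y - g₂ * x)) := by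
  rw [lq_mul, lq_mul, lq_sub, lq_inj]
  refine ⟨?_, ?_, ?_, ?_⟩ <;> ring

lemma exists_of_mem_diffs {S : Set 𝔻} {r N : ℤ}
    (hS : ∀ α ∈ S, ∃ x y z : ℤ, α = lq r x y z ∧ x ^ 2 + y ^ 2 + z ^ 2 = N) {δ : 𝔻}
    (hδ : δ ∈ diffs S) :
    ∃ x y z x' y' z' : ℤ, δ = lq 0 (x - x') (y - y') (z - z') ∧
      lq r x y z ∈ S ∧ lq r x' y' z' ∈ S := by
  obtain ⟨α, hα, β, hβ, rfl⟩ := hδ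
  obtain ⟨x, y, z, rfl, -⟩ := hS α hα
  obtain ⟨x', y', z', rfl, -⟩ := hS β hβ
  exact ⟨x, y, z, x', y', z', by rw [lq_sub, sub_self], hα, hβ⟩

lemma sub_mem_diffs {S : Set 𝔻} {r x y z x' y' z' : ℤ} (h : lq r x y z ∈ S)
    (h' : lq r x' y' z' ∈ S) : lq 0 (x - x') (y - y') (z - z') ∈ diffs S :=
  ⟨_, h, _, h', by rw [lq_sub, sub_self]⟩

lemma norm_eq_of_mem {S : Set 𝔻} {r N : ℤ}
    (hS : ∀ α ∈ S, ∃ x y z : ℤ, α = lq r x y z ∧ x ^ 2 + y ^ 2 + z ^ 2 = N)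
    {x y z : ℤ} (h : lq r x y z ∈ S) : x ^ 2 + y ^ 2 + z ^ 2 = N := by
  obtain ⟨x', y', z', he, h'⟩ := hS _ h
  obtain ⟨-, rfl, rfl, rfl⟩ := lq_inj.1 he
  exact h'

section Necessity

variable {S : Set 𝔻} {r N : ℤ}
  (hS : ∀ α ∈ S, ∃ x y z : ℤ, α = lq r x y z ∧ x ^ 2 + y ^ 2 + z ^ 2 = N)
  (hR : ∀ a : 𝔻, (∀ δ ∈ diffs S, a * δ ∈ Lip) →
    ∀ α ∈ S, ∀ γ ∈ Lip, a * (γ * α - α * γ) ∈ Lip)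
  (hred : IsReducedIn S Lip)

include hS hR

lemma dvdMul_commutator {n : ℤ} (hn : n ≠ 0) {a₀ a₁ a₂ a₃ : ℤ}
    (hD : ∀ x y z, lq 0 x y z ∈ diffs S → DvdMul n a₀ a₁ a₂ a₃ x y z) {x y z : ℤ}
    (hα : lq r x y z ∈ S) (g₁ g₂ g₃ : ℤ) :
    DvdMul n a₀ a₁ a₂ a₃ (2 * (g₂ * z - g₃ * y)) (2 * (g₃ * x - g₁ * z))
      (2 * (g₁ * y - g₂ * x)) := by
  rw [← smul_mul_mem_iff hn, ← commutator_lq r x y z 0]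
  refine hR _ (fun δ hδ => ?_) _ hα _ (lq_mem ..)
  obtain ⟨x, y, z, x', y', z', rfl, -, -⟩ := exists_of_mem_diffs hS hδ
  exact (smul_mul_mem_iff hn ..).2 (hD _ _ _ hδ)

lemma dvd_two_mul_coords {n : ℤ} (hn : n ≠ 0)
    (hD : ∀ x y z, lq 0 x y z ∈ diffs S → n ∣ x ∧ n ∣ y ∧ n ∣ z) {x y z : ℤ}
    (hα : lq r x y z ∈ S) : n ∣ 2 * x ∧ n ∣ 2 * y ∧ n ∣ 2 * z := by
  have hD' : ∀ x y z, lq 0 x y z ∈ diffs S → DvdMul n 1 0 0 0 x y z := by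
    intro x y z h
    simpa [DvdMul] using hD x y z h
  have h1 := dvdMul_commutator hS hR hn hD' hα 1 0 0
  have h2 := dvdMul_commutator hS hR hn hD' hα 0 1 0
  simp [DvdMul] at h1 h2
  exact ⟨h2.2, h1.2, h1.1⟩

include hred

lemma not_forall_four_dvd : ¬ ∀ x y z, lq 0 x y z ∈ diffs S → 4 ∣ x ∧ 4 ∣ y ∧ 4 ∣ z := by
  intro hD
  obtain ⟨x, y, z, hα, hnd⟩ := exists_not_dvd hred hS le_rfl
  have := dvd_two_mul_coords hS hR (by norm_num) hD hα
  omega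

lemma not_forall_two_classes {e₁ e₂ e₃ : ℤ}
    (he : (e₁ = 1 ∧ e₂ = 1 ∧ e₃ = 0) ∨ (e₁ = 1 ∧ e₂ = 0 ∧ e₃ = 1) ∨
      (e₁ = 0 ∧ e₂ = 1 ∧ e₃ = 1)) :
    ¬ ∀ x y z, lq 0 x y z ∈ diffs S → (4 ∣ x ∧ 4 ∣ y ∧ 4 ∣ z) ∨
      (4 ∣ x - 2 * e₁ ∧ 4 ∣ y - 2 * e₂ ∧ 4 ∣ z - 2 * e₃) := by
  intro hD
  obtain ⟨x, y, z, hα, hnd⟩ := exists_not_dvd hred hS le_rfl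
  have hD' : ∀ x y z, lq 0 x y z ∈ diffs S → DvdMul 4 0 e₁ e₂ e₃ x y z := by
    intro x y z h
    have := hD x y z h
    unfold DvdMul
    rcases he with ⟨rfl, rfl, rfl⟩ | ⟨rfl, rfl, rfl⟩ | ⟨rfl, rfl, rfl⟩ <;> omega
  have h1 := dvdMul_commutator hS hR (by norm_num) hD' hα 1 0 0
  have h2 := dvdMul_commutator hS hR (by norm_num) hD' hα 0 1 0
  have h3 := dvdMul_commutator hS hR (by norm_num) hD' hα 0 0 1
  unfold DvdMul at h1 h2 h3
  apply hnd
  rcases he with ⟨rfl, rfl, rfl⟩ | ⟨rfl, rfl, rfl⟩ | ⟨rfl, rfl, rfl⟩ <;> omega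

omit hS hR hred in
lemma cross_eq_zero_of_isotropic {F : Type*} [Field F] {u v w x y z : F}
    (h1 : u ^ 2 + v ^ 2 + w ^ 2 = 0) (h2 : x ^ 2 + y ^ 2 + z ^ 2 = 0)
    (h3 : u * x + v * y + w * z = 0) : v * z - w * y = 0 := by
  set A := v * z - w * y with hA
  set B := w * x - u * z with hB
  set C := u * y - v * x with hC
  have e1 : A * v = B * u := by rw [hA, hB]; linear_combination z * h1 - w * h3
  have e2 : A * w = C * u := by rw [hA, hC]; linear_combination -y * h1 + v * h3
  have e3 : A * y = B * x := by rw [hA, hB]; linear_combination z * h3 - w * h2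
  have e4 : A * z = C * x := by rw [hA, hC]; linear_combination v * h2 - y * h3
  have : A ^ 3 = 0 := by
    have : A ^ 3 = (A * v) * (A * z) - (A * w) * (A * y) := by
      linear_combination A ^ 2 * hA
    rw [this, e1, e2, e3, e4]; ring
  exact eq_zero_of_pow_eq_zero this

omit hS hR hred in
lemma dvd_cross_of_isotropic {p : ℕ} [Fact p.Prime] {u v w x y z : ℤ}
    (h1 : (p : ℤ) ∣ u ^ 2 + v ^ 2 + w ^ 2) (h2 : (p : ℤ) ∣ x ^ 2 + y ^ 2 + z ^ 2)
    (h3 : (p : ℤ) ∣ u * x + v * y + w * z) : (p : ℤ) ∣ v * z - w * y := by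
  simp only [← ZMod.intCast_zmod_eq_zero_iff_dvd] at *
  push_cast at *
  exact cross_eq_zero_of_isotropic h1 h2 h3

lemma not_forall_odd_prime_dvd {p : ℕ} (hp : p.Prime) (hodd : Odd p) :
    ¬ ∀ x y z, lq 0 x y z ∈ diffs S → (p : ℤ) ∣ x ^ 2 + y ^ 2 + z ^ 2 := by
  intro hD
  have := Fact.mk hp
  have hp' : Prime (p : ℤ) := Nat.prime_iff_prime_int.1 hp
  have hp0 : (p : ℤ) ≠ 0 := hp'.ne_zero
  have htwo : ∀ a : ℤ, (p : ℤ) ∣ 2 * a → (p : ℤ) ∣ a := by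
    intro a h
    refine (hp'.dvd_or_dvd h).resolve_left fun h2 => ?_
    have h2' : p ∣ 2 := by exact_mod_cast h2
    rw [(Nat.prime_dvd_prime_iff_eq hp Nat.prime_two).1 h2'] at hodd
    exact absurd hodd (by decide)
  have hinner : ∀ {x y z x' y' z' : ℤ}, lq r x y z ∈ S → lq r x' y' z' ∈ S →
      (p : ℤ) ∣ x * x' + y * y' + z * z' - N := by
    intro x y z x' y' z' h h'
    apply htwo
    refine (dvd_neg.2 (hD _ _ _ (sub_mem_diffs h h'))).trans (dvd_of_eq ?_)
    linear_combination -norm_eq_of_mem hS h - norm_eq_of_mem hS h'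
  obtain ⟨x, y, z, hα, hnd⟩ := exists_not_dvd hred hS (n := (p : ℤ)) (by exact_mod_cast hp.two_le)
  have hall : ∀ u v w, lq 0 u v w ∈ diffs S → (p : ℤ) ∣ u ∧ (p : ℤ) ∣ v ∧ (p : ℤ) ∣ w := by
    intro u v w hδ
    obtain ⟨s, t, q, s', t', q', he, hs, hs'⟩ := exists_of_mem_diffs hS hδ
    obtain ⟨-, rfl, rfl, rfl⟩ := lq_inj.1 he
    have hortho : ∀ {x y z : ℤ}, lq r x y z ∈ S →
        (p : ℤ) ∣ (s - s') * x + (t - t') * y + (q - q') * z := by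
      intro x y z h
      refine (dvd_sub (hinner hs h) (hinner hs' h)).trans (dvd_of_eq ?_)
      ring
    have hD' : ∀ x y z, lq 0 x y z ∈ diffs S →
        DvdMul p 0 (s - s') (t - t') (q - q') x y z := by
      intro x y z h
      have hu := hD _ _ _ hδ
      have hx := hD _ _ _ h
      obtain ⟨k, l, m, k', l', m', he, hk, hk'⟩ := exists_of_mem_diffs hS h
      obtain ⟨-, rfl, rfl, rfl⟩ := lq_inj.1 he
      have hi : (p : ℤ) ∣ (s - s') * (k - k') + (t - t') * (l - l') + (q - q') * (m - m') := by
        refine (dvd_sub (hortho hk) (hortho hk')).trans (dvd_of_eq ?_)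
        ring
      refine ⟨hi, ?_, ?_, ?_⟩
      · simpa using dvd_cross_of_isotropic hu hx hi
      · have := dvd_cross_of_isotropic (p := p) (u := t - t') (v := q - q') (w := s - s')
          (x := l - l') (y := m - m') (z := k - k') (hu.trans (dvd_of_eq (by ring)))
          (hx.trans (dvd_of_eq (by ring))) (hi.trans (dvd_of_eq (by ring)))
        simpa using this
      · have := dvd_cross_of_isotropic (p := p) (u := q - q') (v := s - s') (w := t - t')
          (x := m - m') (y := k - k') (z := l - l') (hu.trans (dvd_of_eq (by ring)))
          (hx.trans (dvd_of_eq (by ring))) (hi.trans (dvd_of_eq (by ring)))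
        simpa using this
    have ho := hortho hα
    obtain ⟨-, a1, a2, a3⟩ := dvdMul_commutator hS hR hp0 hD' hα 1 0 0
    obtain ⟨-, b1, b2, b3⟩ := dvdMul_commutator hS hR hp0 hD' hα 0 1 0
    obtain ⟨-, c1, c2, c3⟩ := dvdMul_commutator hS hR hp0 hD' hα 0 0 1
    have key : ∀ d m : ℤ, (p : ℤ) ∣ d → d = -(2 * m) ∨ d = 2 * m → (p : ℤ) ∣ m := by
      rintro d m h (rfl | rfl)
      · exact htwo _ ((dvd_neg).1 h)
      · exact htwo _ h
    have uy := key _ ((s - s') * y) a2 (Or.inl (by ring))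
    have uz := key _ ((s - s') * z) a3 (Or.inl (by ring))
    have vx := key _ ((t - t') * x) b1 (Or.inl (by ring))
    have vz := key _ ((t - t') * z) b3 (Or.inl (by ring))
    have wx := key _ ((q - q') * x) c1 (Or.inl (by ring))
    have wy := key _ ((q - q') * y) c2 (Or.inl (by ring))
    have ux : (p : ℤ) ∣ (s - s') * x := htwo _ 
      ((dvd_sub (ho.mul_left 2) a1).trans (dvd_of_eq (by ring)))
    have vy : (p : ℤ) ∣ (t - t') * y := htwo _ 
      ((dvd_sub (ho.mul_left 2) b2).trans (dvd_of_eq (by ring)))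
    have wz : (p : ℤ) ∣ (q - q') * z := htwo _ 
      ((dvd_sub (ho.mul_left 2) c3).trans (dvd_of_eq (by ring)))
    have cl : ∀ d : ℤ, (p : ℤ) ∣ d * x → (p : ℤ) ∣ d * y → (p : ℤ) ∣ d * z → (p : ℤ) ∣ d := by
      intro d hdx hdy hdz
      by_contra hd
      exact hnd ⟨(hp'.dvd_or_dvd hdx).resolve_left hd, (hp'.dvd_or_dvd hdy).resolve_left hd,
        (hp'.dvd_or_dvd hdz).resolve_left hd⟩
    exact ⟨cl _ ux uy uz, cl _ vx vy vz, cl _ wx wy wz⟩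
  obtain ⟨h1, h2, h3⟩ := dvd_two_mul_coords hS hR hp0 hall hα
  exact hnd ⟨htwo _ h1, htwo _ h2, htwo _ h3⟩

end Necessity

/-- Some difference is congruent to `2 (e₁ i + e₂ j + e₃ k)` modulo `4`. -/
def HasClass (S : Set 𝔻) (e₁ e₂ e₃ : ℤ) : Prop :=
  ∃ x y z : ℤ, lq 0 x y z ∈ diffs S ∧ 4 ∣ x - 2 * e₁ ∧ 4 ∣ y - 2 * e₂ ∧ 4 ∣ z - 2 * e₃

lemma exists_congr_iff_hasClass {S : Set 𝔻} {r N : ℤ}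
    (hS : ∀ α ∈ S, ∃ x y z : ℤ, α = lq r x y z ∧ x ^ 2 + y ^ 2 + z ^ 2 = N) (e₁ e₂ e₃ : ℤ) :
    (∃ δ ∈ diffs S, δ - lq 0 (2 * e₁) (2 * e₂) (2 * e₃) ∈ scaleSet 4 Lip) ↔
      HasClass S e₁ e₂ e₃ := by
  constructor
  · rintro ⟨δ, hδ, h⟩
    obtain ⟨x, y, z, x', y', z', rfl, -, -⟩ := exists_of_mem_diffs hS hδ
    rw [lq_sub, mem_scaleSet_iff] at h
    exact ⟨_, _, _, hδ, h.2⟩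
  · rintro ⟨x, y, z, hδ, h⟩
    refine ⟨_, hδ, ?_⟩
    rw [lq_sub, mem_scaleSet_iff]
    exact ⟨by simp, h⟩

lemma exists_distinct_classes_iff {S : Set 𝔻} {r N : ℤ}
    (hS : ∀ α ∈ S, ∃ x y z : ℤ, α = lq r x y z ∧ x ^ 2 + y ^ 2 + z ^ 2 = N) :
    (∃ δ₁ ∈ diffs S, ∃ δ₂ ∈ diffs S,
      ∃ r₁ ∈ ({2 * qi + 2 * qj, 2 * qi + 2 * qk, 2 * qj + 2 * qk} : Set 𝔻),
      ∃ r₂ ∈ ({2 * qi + 2 * qj, 2 * qi + 2 * qk, 2 * qj + 2 * qk} : Set 𝔻),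
        r₁ ≠ r₂ ∧ δ₁ - r₁ ∈ scaleSet 4 Lip ∧ δ₂ - r₂ ∈ scaleSet 4 Lip) ↔
      (HasClass S 1 1 0 ∧ HasClass S 1 0 1) ∨ (HasClass S 1 1 0 ∧ HasClass S 0 1 1) ∨
        (HasClass S 1 0 1 ∧ HasClass S 0 1 1) := by
  have h2 : (2 : 𝔻) = lq 2 0 0 0 := intCast_eq_lq 2
  have hi : qi = lq 0 1 0 0 := by ext <;> simp [qi]
  have hj : qj = lq 0 0 1 0 := by ext <;> simp [qj]
  have hk : qk = lq 0 0 0 1 := by ext <;> simp [qk]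
  have hij : 2 * qi + 2 * qj = lq 0 (2 * 1) (2 * 1) (2 * 0) := by
    simp [h2, hi, hj, lq_mul, lq_add]
  have hik : 2 * qi + 2 * qk = lq 0 (2 * 1) (2 * 0) (2 * 1) := by
    simp [h2, hi, hk, lq_mul, lq_add]
  have hjk : 2 * qj + 2 * qk = lq 0 (2 * 0) (2 * 1) (2 * 1) := by
    simp [h2, hj, hk, lq_mul, lq_add]
  have hne₁ : lq 0 (2 * 1) (2 * 1) (2 * 0) ≠ lq 0 (2 * 1) (2 * 0) (2 * 1) := by
    simp [lq_inj]
  have hne₂ : lq 0 (2 * 1) (2 * 1) (2 * 0) ≠ lq 0 (2 * 0) (2 * 1) (2 * 1) := by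
    simp [lq_inj]
  have hne₃ : lq 0 (2 * 1) (2 * 0) (2 * 1) ≠ lq 0 (2 * 0) (2 * 1) (2 * 1) := by
    simp [lq_inj]
  rw [hij, hik, hjk]
  simp only [← exists_congr_iff_hasClass hS, Set.mem_insert_iff, Set.mem_singleton_iff]
  constructor
  · rintro ⟨δ₁, h₁, δ₂, h₂, r₁, hr₁, r₂, hr₂, hne, hδ₁, hδ₂⟩
    rcases hr₁ with rfl | rfl | rfl <;> rcases hr₂ with rfl | rfl | rfl
    · exact absurd rfl hne
    · exact .inl ⟨⟨_, h₁, hδ₁⟩, _, h₂, hδ₂⟩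
    · exact .inr (.inl ⟨⟨_, h₁, hδ₁⟩, _, h₂, hδ₂⟩)
    · exact .inl ⟨⟨_, h₂, hδ₂⟩, _, h₁, hδ₁⟩
    · exact absurd rfl hne
    · exact .inr (.inr ⟨⟨_, h₁, hδ₁⟩, _, h₂, hδ₂⟩)
    · exact .inr (.inl ⟨⟨_, h₂, hδ₂⟩, _, h₁, hδ₁⟩)
    · exact .inr (.inr ⟨⟨_, h₂, hδ₂⟩, _, h₁, hδ₁⟩)
    · exact absurd rfl hne
  · rintro (⟨⟨δ₁, h₁, hδ₁⟩, δ₂, h₂, hδ₂⟩ | ⟨⟨δ₁, h₁, hδ₁⟩, δ₂, h₂, hδ₂⟩ |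
      ⟨⟨δ₁, h₁, hδ₁⟩, δ₂, h₂, hδ₂⟩)
    · exact ⟨δ₁, h₁, δ₂, h₂, _, by simp, _, by simp, hne₁, hδ₁, hδ₂⟩
    · exact ⟨δ₁, h₁, δ₂, h₂, _, by simp, _, by simp, hne₂, hδ₁, hδ₂⟩
    · exact ⟨δ₁, h₁, δ₂, h₂, _, by simp, _, by simp, hne₃, hδ₁, hδ₂⟩

lemma gam_dvd {S : Set 𝔻} (hsub : S ⊆ Lip) (hcard : S.Nontrivial) {x y z : ℤ}
    (h : lq 0 x y z ∈ diffs S) : (gam S : ℤ) ∣ x ^ 2 + y ^ 2 + z ^ 2 :=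
  (gam_spec hsub hcard).2.1 _ ⟨_, h, by rw [qnorm_lq]; push_cast; ring⟩

lemma dvd_gam {S : Set 𝔻} {r N : ℤ}
    (hS : ∀ α ∈ S, ∃ x y z : ℤ, α = lq r x y z ∧ x ^ 2 + y ^ 2 + z ^ 2 = N)
    (hsub : S ⊆ Lip) (hcard : S.Nontrivial) {g : ℕ}
    (hg : ∀ x y z, lq 0 x y z ∈ diffs S → (g : ℤ) ∣ x ^ 2 + y ^ 2 + z ^ 2) : g ∣ gam S := by
  refine (gam_spec hsub hcard).2.2 g ?_
  rintro t ⟨δ, hδ, ht⟩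
  obtain ⟨x, y, z, x', y', z', rfl, -, -⟩ := exists_of_mem_diffs hS hδ
  rw [qnorm_lq, Int.cast_inj] at ht
  rw [ht]
  simpa using hg _ _ _ hδ

lemma even_of_four_dvd {x y z : ℤ} (h : 4 ∣ x ^ 2 + y ^ 2 + z ^ 2) : 2 ∣ x ∧ 2 ∣ y ∧ 2 ∣ z := by
  rcases Int.even_or_odd' x with ⟨u, rfl | rfl⟩ <;>
    rcases Int.even_or_odd' y with ⟨v, rfl | rfl⟩ <;>
    rcases Int.even_or_odd' z with ⟨w, rfl | rfl⟩ <;> ring_nf at h <;> omega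

lemma ringset_imp_gam {S : Set 𝔻} {r N : ℤ}
    (hS : ∀ α ∈ S, ∃ x y z : ℤ, α = lq r x y z ∧ x ^ 2 + y ^ 2 + z ^ 2 = N)
    (hsub : S ⊆ Lip) (hred : IsReducedIn S Lip) (hcard : S.Nontrivial)
    (hR : ∀ a : 𝔻, (∀ δ ∈ diffs S, a * δ ∈ Lip) →
      ∀ α ∈ S, ∀ γ ∈ Lip, a * (γ * α - α * γ) ∈ Lip) :
    gam S = 2 ∨ gam S = 4 ∨ gam S = 8 := by
  have h2 : 2 ∣ gam S := dvd_gam hS hsub hcard fun x y z h => by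
    obtain ⟨x, y, z, x', y', z', he, hα, hβ⟩ := exists_of_mem_diffs hS h
    obtain ⟨-, rfl, rfl, rfl⟩ := lq_inj.1 he
    refine ⟨N - (x * x' + y * y' + z * z'), ?_⟩
    push_cast
    linear_combination norm_eq_of_mem hS hα + norm_eq_of_mem hS hβ
  rcases Nat.eq_two_pow_or_exists_odd_prime_and_dvd (gam S) with ⟨k, hk⟩ | ⟨p, hp, hpd, hodd⟩
  · have hk0 : k ≠ 0 := by
      rintro rfl
      rw [hk] at h2
      norm_num at h2
    have hk4 : k < 4 := by
      by_contra! hk4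
      have h16 : (16 : ℤ) ∣ gam S := by
        have : 2 ^ 4 ∣ gam S := hk ▸ pow_dvd_pow 2 hk4
        exact_mod_cast this
      refine not_forall_four_dvd hS hR hred fun x y z h => ?_
      have hd := h16.trans (gam_dvd hsub hcard h)
      obtain ⟨⟨u, rfl⟩, ⟨v, rfl⟩, ⟨w, rfl⟩⟩ :=
        even_of_four_dvd (x := x) (y := y) (z := z) (by omega)
      have := even_of_four_dvd (x := u) (y := v) (z := w) (by ring_nf at hd ⊢; omega)
      omega
    interval_cases k <;> simp_all
  · exact absurd (fun x y z h => (Int.natCast_dvd_natCast.2 hpd).trans (gam_dvd hsub hcard h))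
      (not_forall_odd_prime_dvd hS hR hred hp hodd)

lemma classes_of_eight_dvd {x y z : ℤ} (h : 8 ∣ x ^ 2 + y ^ 2 + z ^ 2) :
    (4 ∣ x ∧ 4 ∣ y ∧ 4 ∣ z) ∨ (4 ∣ x - 2 * 1 ∧ 4 ∣ y - 2 * 1 ∧ 4 ∣ z - 2 * 0) ∨
      (4 ∣ x - 2 * 1 ∧ 4 ∣ y - 2 * 0 ∧ 4 ∣ z - 2 * 1) ∨
        (4 ∣ x - 2 * 0 ∧ 4 ∣ y - 2 * 1 ∧ 4 ∣ z - 2 * 1) := by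
  obtain ⟨⟨u, rfl⟩, ⟨v, rfl⟩, ⟨w, rfl⟩⟩ := even_of_four_dvd (x := x) (y := y) (z := z) (by omega)
  rcases Int.even_or_odd' u with ⟨u, rfl | rfl⟩ <;>
    rcases Int.even_or_odd' v with ⟨v, rfl | rfl⟩ <;>
    rcases Int.even_or_odd' w with ⟨w, rfl | rfl⟩ <;> ring_nf at h <;> omega

lemma ringset_imp_hasClass {S : Set 𝔻} {r N : ℤ}
    (hS : ∀ α ∈ S, ∃ x y z : ℤ, α = lq r x y z ∧ x ^ 2 + y ^ 2 + z ^ 2 = N)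
    (hsub : S ⊆ Lip) (hred : IsReducedIn S Lip) (hcard : S.Nontrivial)
    (hR : ∀ a : 𝔻, (∀ δ ∈ diffs S, a * δ ∈ Lip) →
      ∀ α ∈ S, ∀ γ ∈ Lip, a * (γ * α - α * γ) ∈ Lip) (h8 : gam S = 8) :
    (HasClass S 1 1 0 ∧ HasClass S 1 0 1) ∨ (HasClass S 1 1 0 ∧ HasClass S 0 1 1) ∨
        (HasClass S 1 0 1 ∧ HasClass S 0 1 1) := by
  by_contra hcon
  have hD : ∀ x y z, lq 0 x y z ∈ diffs S →
      (4 ∣ x ∧ 4 ∣ y ∧ 4 ∣ z) ∨ (HasClass S 1 1 0 ∧ 4 ∣ x - 2 * 1 ∧ 4 ∣ y - 2 * 1 ∧ 4 ∣ z - 2 * 0) ∨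
      (HasClass S 1 0 1 ∧ 4 ∣ x - 2 * 1 ∧ 4 ∣ y - 2 * 0 ∧ 4 ∣ z - 2 * 1) ∨
        (HasClass S 0 1 1 ∧ 4 ∣ x - 2 * 0 ∧ 4 ∣ y - 2 * 1 ∧ 4 ∣ z - 2 * 1) := by
    intro x y z h
    have hd := gam_dvd hsub hcard h
    rw [h8] at hd
    rcases classes_of_eight_dvd hd with h0 | h0 | h0 | h0
    · exact .inl h0
    · exact .inr (.inl ⟨⟨_, _, _, h, h0⟩, h0⟩)
    · exact .inr (.inr (.inl ⟨⟨_, _, _, h, h0⟩, h0⟩))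
    · exact .inr (.inr (.inr ⟨⟨_, _, _, h, h0⟩, h0⟩))
  by_cases h1 : HasClass S 1 1 0
  · exact not_forall_two_classes hS hR hred (e₁ := 1) (e₂ := 1) (e₃ := 0) (by simp)
      fun x y z h => by have := hD x y z h; tauto
  by_cases h2 : HasClass S 1 0 1
  · exact not_forall_two_classes hS hR hred (e₁ := 1) (e₂ := 0) (e₃ := 1) (by simp)
      fun x y z h => by have := hD x y z h; tauto
  · exact not_forall_two_classes hS hR hred (e₁ := 0) (e₂ := 1) (e₃ := 1) (by simp)
      fun x y z h => by have := hD x y z h; tauto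

section Sufficiency

variable {a : 𝔻}

lemma mul_lq_sub {x y z w x' y' z' w' : ℤ} (h : a * lq x y z w ∈ Lip)
    (h' : a * lq x' y' z' w' ∈ Lip) : a * lq (x - x') (y - y') (z - z') (w - w') ∈ Lip := by
  rw [← lq_sub, mul_sub]; exact lip_sub h h'

lemma mul_lq_mul {x y z w : ℤ} (n : ℤ) (h : a * lq x y z w ∈ Lip) :
    a * lq (n * x) (n * y) (n * z) (n * w) ∈ Lip := by
  have := lip_mul h (lq_mem n 0 0 0)
  rw [mul_assoc, lq_mul] at this
  convert this using 3 <;> ring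

/-- The integers `n` with `a n` a Lipschitz quaternion. -/
def denomIdeal (a : 𝔻) : Ideal ℤ where
  carrier := {n | a * lq n 0 0 0 ∈ Lip}
  add_mem' {m n} hm hn := by
    have := lip_add hm hn
    rwa [← mul_add, lq_add] at this
  zero_mem' := by
    rw [Set.mem_ofPred_eq, ← intCast_eq_lq, Int.cast_zero, mul_zero, ← Int.cast_zero,
      intCast_eq_lq]
    exact lq_mem ..
  smul_mem' n m hm := by simpa using mul_lq_mul n hm

lemma mem_denomIdeal {n : ℤ} : n ∈ denomIdeal a ↔ a * lq n 0 0 0 ∈ Lip := Iff.rfl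

/-- Multiply a difference by half of its conjugate. -/
lemma two_mul_norm_mem_denomIdeal {u v w : ℤ} (h : a * lq 0 (2 * u) (2 * v) (2 * w) ∈ Lip) :
    2 * (u ^ 2 + v ^ 2 + w ^ 2) ∈ denomIdeal a := by
  have := lip_mul h (lq_mem 0 (-u) (-v) (-w))
  rw [mul_assoc, lq_mul] at this
  rw [mem_denomIdeal]
  convert this using 3 <;> ring

lemma norm_mem_denomIdeal {x y z : ℤ} (h : a * lq 0 x y z ∈ Lip) :
    x ^ 2 + y ^ 2 + z ^ 2 ∈ denomIdeal a := by
  have := lip_mul h (lq_mem 0 (-x) (-y) (-z))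
  rw [mul_assoc, lq_mul] at this
  rw [mem_denomIdeal]
  convert this using 3 <;> ring

variable {S : Set 𝔻} {r N : ℤ}
  (hS : ∀ α ∈ S, ∃ x y z : ℤ, α = lq r x y z ∧ x ^ 2 + y ^ 2 + z ^ 2 = N)
  (hsub : S ⊆ Lip) (hcard : S.Nontrivial) (ha : ∀ δ ∈ diffs S, a * δ ∈ Lip)

include hS hsub hcard ha

lemma gam_mem_denomIdeal : (gam S : ℤ) ∈ denomIdeal a := by
  obtain ⟨g, hg⟩ := (IsPrincipalIdealRing.principal (denomIdeal a)).principal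
  change denomIdeal a = Ideal.span {g} at hg
  have : g.natAbs ∣ gam S := dvd_gam hS hsub hcard fun x y z h => by
    have := norm_mem_denomIdeal (ha _ h)
    rw [hg, Ideal.mem_span_singleton] at this
    exact Int.natAbs_dvd.2 this
  rw [hg, Ideal.mem_span_singleton]
  exact Int.natAbs_dvd.1 (Int.natCast_dvd_natCast.2 this)

lemma two_mem_denomIdeal (hgam : gam S = 2 ∨ gam S = 4) : 2 ∈ denomIdeal a := by
  have hmem := gam_mem_denomIdeal hS hsub hcard ha
  rcases hgam with hgam | hgam <;> rw [hgam] at hmem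
  · exact hmem
  · by_contra h2
    have : 8 ∣ gam S := dvd_gam hS hsub hcard fun x y z h => by
      have hd := gam_dvd hsub hcard h
      rw [hgam] at hd
      obtain ⟨⟨u, rfl⟩, ⟨v, rfl⟩, ⟨w, rfl⟩⟩ :=
        even_of_four_dvd (x := x) (y := y) (z := z) (by exact_mod_cast hd)
      have hu := two_mul_norm_mem_denomIdeal (ha _ h)
      rcases Int.even_or_odd' (u ^ 2 + v ^ 2 + w ^ 2) with ⟨k, hk | hk⟩
      · exact ⟨k, by push_cast; linear_combination 4 * hk⟩
      · refine absurd ?_ h2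
        convert sub_mem hu (Ideal.mul_mem_left _ k hmem) using 1
        push_cast
        linear_combination -2 * hk
    rw [hgam] at this
    omega

omit hcard hsub ha in
lemma commutator_mem_of_two_mem (h2 : 2 ∈ denomIdeal a) :
    ∀ α ∈ S, ∀ γ ∈ Lip, a * (γ * α - α * γ) ∈ Lip := by
  intro α hα γ hγ
  obtain ⟨x, y, z, rfl, -⟩ := hS α hα
  obtain ⟨g₀, g₁, g₂, g₃, rfl⟩ := mem_Lip_iff.1 hγ
  rw [commutator_lq]
  have := lip_mul (mem_denomIdeal.1 h2)
    (lq_mem 0 (g₂ * z - g₃ * y) (g₃ * x - g₁ * z) (g₁ * y - g₂ * x))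
  rw [mul_assoc, lq_mul] at this
  convert this using 3 <;> ring

omit hcard hsub hS in
lemma four_mem_denomIdeal (h8 : 8 ∈ denomIdeal a) {e₁ e₂ e₃ : ℤ}
    (he : e₁ ^ 2 + e₂ ^ 2 + e₃ ^ 2 = 2) (h : HasClass S e₁ e₂ e₃) : 4 ∈ denomIdeal a := by
  obtain ⟨x, y, z, hδ, ⟨k, hk⟩, ⟨l, hl⟩, ⟨m, hm⟩⟩ := h
  obtain rfl : x = 2 * (e₁ + 2 * k) := by linarith
  obtain rfl : y = 2 * (e₂ + 2 * l) := by linarith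
  obtain rfl : z = 2 * (e₃ + 2 * m) := by linarith
  have := two_mul_norm_mem_denomIdeal (ha _ hδ)
  convert sub_mem this (Ideal.mul_mem_left _
    (k * e₁ + l * e₂ + m * e₃ + k ^ 2 + l ^ 2 + m ^ 2) h8) using 1
  linear_combination -2 * he

omit hcard hsub hS in
lemma mul_class_mem (h4 : 4 ∈ denomIdeal a) {e₁ e₂ e₃ : ℤ} (h : HasClass S e₁ e₂ e₃) :
    a * lq 0 (2 * e₁) (2 * e₂) (2 * e₃) ∈ Lip := by
  obtain ⟨x, y, z, hδ, ⟨k, hk⟩, ⟨l, hl⟩, ⟨m, hm⟩⟩ := h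
  have := lip_mul (mem_denomIdeal.1 h4) (lq_mem 0 k l m)
  rw [mul_assoc, lq_mul] at this
  convert mul_lq_sub (ha _ hδ) this using 3 <;> linarith

omit hcard hsub ha in
lemma even_inner_of_hasClass {e₁ e₂ e₃ : ℤ} (he : e₁ ^ 2 + e₂ ^ 2 + e₃ ^ 2 = 2)
    (h : HasClass S e₁ e₂ e₃) (hD : ∀ x y z, lq 0 x y z ∈ diffs S → 2 ∣ x ∧ 2 ∣ y ∧ 2 ∣ z)
    {x y z : ℤ} (hα : lq r x y z ∈ S) : 2 ∣ e₁ * x + e₂ * y + e₃ * z := by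
  obtain ⟨s, t, q, hδ, ⟨k, hk⟩, ⟨l, hl⟩, ⟨m, hm⟩⟩ := h
  obtain ⟨s, t, q, s', t', q', heq, hs, hs'⟩ := exists_of_mem_diffs hS hδ
  obtain ⟨-, rfl, rfl, rfl⟩ := lq_inj.1 heq
  obtain ⟨⟨u, hu⟩, ⟨v, hv⟩, ⟨w, hw⟩⟩ := hD _ _ _ (sub_mem_diffs hα hs')
  obtain rfl : s = s' + 2 * e₁ + 4 * k := by linarith
  obtain rfl : t = t' + 2 * e₂ + 4 * l := by linarith
  obtain rfl : q = q' + 2 * e₃ + 4 * m := by linarith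
  obtain rfl : x = s' + 2 * u := by linarith
  obtain rfl : y = t' + 2 * v := by linarith
  obtain rfl : z = q' + 2 * w := by linarith
  refine ⟨e₁ * u + e₂ * v + e₃ * w - (1 + k * s' + l * t' + m * q' + 2 * (k * e₁ + l * e₂ + m * e₃)
    + 2 * (k ^ 2 + l ^ 2 + m ^ 2)), ?_⟩
  have h1 := norm_eq_of_mem hS hs
  have h2 := norm_eq_of_mem hS hs'
  have h4 : 4 * (e₁ * s' + e₂ * t' + e₃ * q' + 2 + 2 * (k * s' + l * t' + m * q') +
      4 * (k * e₁ + l * e₂ + m * e₃) + 4 * (k ^ 2 + l ^ 2 + m ^ 2)) = 0 := by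
    linear_combination h1 - h2 - 4 * he
  linarith

lemma commutator_mem_of_gam_eq_eight (hgam : gam S = 8)
    (h : (HasClass S 1 1 0 ∧ HasClass S 1 0 1) ∨ (HasClass S 1 1 0 ∧ HasClass S 0 1 1) ∨
        (HasClass S 1 0 1 ∧ HasClass S 0 1 1)) :
    ∀ α ∈ S, ∀ γ ∈ Lip, a * (γ * α - α * γ) ∈ Lip := by
  have h8 := gam_mem_denomIdeal hS hsub hcard ha
  rw [hgam] at h8
  have h4 : 4 ∈ denomIdeal a := by
    rcases h with h | h | h <;> exact four_mem_denomIdeal ha h8 (by norm_num) h.1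
  have hD : ∀ x y z, lq 0 x y z ∈ diffs S → 2 ∣ x ∧ 2 ∣ y ∧ 2 ∣ z := fun x y z h => by
    have := gam_dvd hsub hcard h
    rw [hgam] at this
    exact even_of_four_dvd (by omega)
  have hodd : a * lq 0 2 2 0 ∈ Lip ∧ a * lq 0 2 0 2 ∈ Lip := by
    have hk : a * lq 0 0 0 4 ∈ Lip := by
      simpa [lq_mul, mul_assoc] using lip_mul (mem_denomIdeal.1 h4) (lq_mem 0 0 0 1)
    have hj : a * lq 0 0 4 0 ∈ Lip := by
      simpa [lq_mul, mul_assoc] using lip_mul (mem_denomIdeal.1 h4) (lq_mem 0 0 1 0)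
    rcases h with ⟨h, h'⟩ | ⟨h, h'⟩ | ⟨h, h'⟩
    · exact ⟨mul_class_mem ha h4 h, mul_class_mem ha h4 h'⟩
    · refine ⟨mul_class_mem ha h4 h, ?_⟩
      have := mul_lq_sub (mul_class_mem ha h4 h) (mul_class_mem ha h4 h')
      simpa using mul_lq_sub this (mul_lq_mul (-1) hk)
    · refine ⟨?_, mul_class_mem ha h4 h⟩
      have := mul_lq_sub (mul_class_mem ha h4 h) (mul_class_mem ha h4 h')
      simpa using mul_lq_sub this (mul_lq_mul (-1) hj)
  intro α hα γ hγ
  obtain ⟨x, y, z, rfl, -⟩ := hS α hα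
  obtain ⟨g₀, g₁, g₂, g₃, rfl⟩ := mem_Lip_iff.1 hγ
  have hpar : 2 ∣ x - y ∧ 2 ∣ x - z := by
    rcases h with ⟨h, h'⟩ | ⟨h, h'⟩ | ⟨h, h'⟩ <;>
    · have h1 := even_inner_of_hasClass hS (by norm_num) h hD hα
      have h2 := even_inner_of_hasClass hS (by norm_num) h' hD hα
      omega
  obtain ⟨⟨s, hs⟩, ⟨t, ht⟩⟩ := hpar
  obtain rfl : y = x - 2 * s := by linarith
  obtain rfl : z = x - 2 * t := by linarith
  rw [commutator_lq]
  set w₁ := g₂ * (x - 2 * t) - g₃ * (x - 2 * s) with hw₁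
  set w₂ := g₃ * x - g₁ * (x - 2 * t) with hw₂
  set w₃ := g₁ * (x - 2 * s) - g₂ * x with hw₃
  have hi := lip_mul (mem_denomIdeal.1 h4)
    (lq_mem 0 (-(-g₂ * t + g₃ * s - g₁ * t + g₁ * s + (g₂ - g₃) * x)) 0 0)
  rw [mul_assoc, lq_mul] at hi
  have hsum := mul_lq_sub (mul_lq_sub (mul_lq_mul w₂ hodd.1) (mul_lq_mul (-w₃) hodd.2)) hi
  convert hsum using 3 <;> ring

end Sufficiency

/-- Theorem (main, Lipschitz case): classification of reduced ringsets of L. -/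
theorem stmt_0 (S : Set 𝔻) (hsub : S ⊂ Lip) (hred : IsReducedIn S Lip)
    (hcard : S.Nontrivial) :
    IsRingset S Lip ↔
      (gam S = 2 ∨ gam S = 4 ∨
        (gam S = 8 ∧ ∃ δ₁ ∈ diffs S, ∃ δ₂ ∈ diffs S,
          ∃ r₁ ∈ ({2 * qi + 2 * qj, 2 * qi + 2 * qk, 2 * qj + 2 * qk} : Set 𝔻),
          ∃ r₂ ∈ ({2 * qi + 2 * qj, 2 * qi + 2 * qk, 2 * qj + 2 * qk} : Set 𝔻),
            r₁ ≠ r₂ ∧ δ₁ - r₁ ∈ scaleSet 4 Lip ∧ δ₂ - r₂ ∈ scaleSet 4 Lip)) := by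
  obtain ⟨r, N, hS⟩ := coords_of_reduced hred hcard.nonempty
  have hquad : ∀ α ∈ S, α * α = (2 * r : ℚ) • α + (-(r ^ 2 + N) : ℚ) • 1 := by
    intro α hα
    obtain ⟨x, y, z, rfl, rfl⟩ := hS α hα
    ext <;> simp <;> ring
  rw [isRingset_iff hquad, exists_distinct_classes_iff hS]
  constructor
  · intro hR
    rcases ringset_imp_gam hS hsub.subset hred hcard hR with h | h | h
    · exact .inl h
    · exact .inr (.inl h)
    · exact .inr (.inr ⟨h, ringset_imp_hasClass hS hsub.subset hred hcard hR h⟩)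
  · rintro (h | h | ⟨h, h'⟩) a ha
    · exact commutator_mem_of_two_mem hS
        (two_mem_denomIdeal hS hsub.subset hcard ha (.inl h))
    · exact commutator_mem_of_two_mem hS
        (two_mem_denomIdeal hS hsub.subset hcard ha (.inr h))
    · exact commutator_mem_of_gam_eq_eight hS hsub.subset hcard ha h h'
end
end

section
/- Let S be a reduced proper subset of the Hurwitz quaternions H with |S| ≥ 2. Then S is a ringset of H if and only if Γ(S) = 1 or Γ(S) = 2. -/
noncomputable section

open Polynomial

theorem mem_Hur_iff {x : 𝔻} : x ∈ Hur ↔ ∃ t b c d : ℤ,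
    x.re = t / 2 ∧ x.imI = t / 2 + b ∧ x.imJ = t / 2 + c ∧ x.imK = t / 2 + d := by
  constructor
  · rintro (⟨⟨a, ha⟩, ⟨b, hb⟩, ⟨c, hc⟩, ⟨d, hd⟩⟩ | ⟨⟨a, ha⟩, ⟨b, hb⟩, ⟨c, hc⟩, ⟨d, hd⟩⟩)
    · refine ⟨2 * a, b - a, c - a, d - a, ?_, ?_, ?_, ?_⟩ <;> simp only [*] <;> push_cast <;> ring
    · refine ⟨2 * a + 1, b - a, c - a, d - a, ?_, ?_, ?_, ?_⟩ <;> simp only [*] <;> push_cast <;>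
        ring
  · rintro ⟨t, b, c, d, h0, h1, h2, h3⟩
    obtain ⟨s, rfl | rfl⟩ := Int.even_or_odd' t
    · refine Or.inl ⟨⟨s, ?_⟩, ⟨s + b, ?_⟩, ⟨s + c, ?_⟩, ⟨s + d, ?_⟩⟩ <;> simp only [*] <;>
        push_cast <;> ring
    · refine Or.inr ⟨⟨s, ?_⟩, ⟨s + b, ?_⟩, ⟨s + c, ?_⟩, ⟨s + d, ?_⟩⟩ <;> simp only [*] <;>
        push_cast <;> ring

theorem mul_mem_Hur {x y : 𝔻} (hx : x ∈ Hur) (hy : y ∈ Hur) : x * y ∈ Hur := by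
  rw [mem_Hur_iff] at *
  obtain ⟨t, b, c, d, h0, h1, h2, h3⟩ := hx
  obtain ⟨t', b', c', d', h0', h1', h2', h3'⟩ := hy
  refine ⟨-t * t' - t * (b' + c' + d') - t' * (b + c + d) - 2 * (b * b' + c * c' + d * d'),
    t * t' + t * b' + t * d' + t' * b + t' * c + (b * b' + c * c' + d * d') + c * d' - d * c',
    t * t' + t * c' + t * b' + t' * c + t' * d + (b * b' + c * c' + d * d') + d * b' - b * d',
    t * t' + t * d' + t * c' + t' * d + t' * b + (b * b' + c * c' + d * d') + b * c' - c * b',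
    ?_, ?_, ?_, ?_⟩ <;>
  simp only [Quaternion.re_mul, Quaternion.imI_mul, Quaternion.imJ_mul, Quaternion.imK_mul, *] <;>
  push_cast <;> ring

/-- The Hurwitz quaternions as a subring. -/
def hurwitz : Subring 𝔻 where
  carrier := Hur
  mul_mem' := mul_mem_Hur
  one_mem' := mem_Hur_iff.2 ⟨2, -1, -1, -1,
    (by norm_num : (1 : ℚ) = _), (by norm_num : (0 : ℚ) = _), (by norm_num : (0 : ℚ) = _),
    (by norm_num : (0 : ℚ) = _)⟩
  zero_mem' := mem_Hur_iff.2 ⟨0, 0, 0, 0,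
    (by simp : (0 : ℚ) = _), (by simp : (0 : ℚ) = _), (by simp : (0 : ℚ) = _),
    (by simp : (0 : ℚ) = _)⟩
  add_mem' := by
    intro x y hx hy
    rw [mem_Hur_iff] at *
    obtain ⟨t, b, c, d, h0, h1, h2, h3⟩ := hx
    obtain ⟨t', b', c', d', h0', h1', h2', h3'⟩ := hy
    refine ⟨t + t', b + b', c + c', d + d', ?_, ?_, ?_, ?_⟩ <;>
    simp only [Quaternion.re_add, Quaternion.imI_add, Quaternion.imJ_add, Quaternion.imK_add, *] <;>
    push_cast <;> ring
  neg_mem' := by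
    intro x hx
    rw [mem_Hur_iff] at *
    obtain ⟨t, b, c, d, h0, h1, h2, h3⟩ := hx
    refine ⟨-t, -b, -c, -d, ?_, ?_, ?_, ?_⟩ <;>
    simp only [Quaternion.re_neg, Quaternion.imI_neg, Quaternion.imJ_neg, Quaternion.imK_neg, *] <;>
    push_cast <;> ring

/-- A Hurwitz quaternion with vanishing real part has integral coordinates. -/
theorem exists_int_coords_of_re_eq_zero {x : 𝔻} (hx : x ∈ Hur) (h : x.re = 0) :
    ∃ b c d : ℤ, x.imI = b ∧ x.imJ = c ∧ x.imK = d := by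
  obtain ⟨t, b, c, d, h0, h1, h2, h3⟩ := mem_Hur_iff.1 hx
  have ht : (t : ℚ) / 2 = 0 := by rw [← h0, h]
  exact ⟨b, c, d, by simp [*], by simp [*], by simp [*]⟩

theorem Lip_subset_Hur : Lip ⊆ Hur := Set.subset_union_left

/-- The quaternion with the given coordinates. -/
def quat (a b c d : ℚ) : 𝔻 := QuaternionAlgebra.mk a b c d

@[simp] theorem quat_re (a b c d : ℚ) : (quat a b c d).re = a := rfl
@[simp] theorem quat_imI (a b c d : ℚ) : (quat a b c d).imI = b := rfl
@[simp] theorem quat_imJ (a b c d : ℚ) : (quat a b c d).imJ = c := rfl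
@[simp] theorem quat_imK (a b c d : ℚ) : (quat a b c d).imK = d := rfl

/-- The purely imaginary quaternion with the given integral coordinates. -/
def imag (x y z : ℤ) : 𝔻 := quat 0 x y z

@[simp] theorem imag_re (x y z : ℤ) : (imag x y z).re = 0 := rfl
@[simp] theorem imag_imI (x y z : ℤ) : (imag x y z).imI = x := rfl
@[simp] theorem imag_imJ (x y z : ℤ) : (imag x y z).imJ = y := rfl
@[simp] theorem imag_imK (x y z : ℤ) : (imag x y z).imK = z := rfl

theorem imag_mem_Hur (x y z : ℤ) : imag x y z ∈ Hur :=
  Lip_subset_Hur ⟨⟨0, by simp⟩, ⟨x, rfl⟩, ⟨y, rfl⟩, ⟨z, rfl⟩⟩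

theorem qnorm_imag (x y z : ℤ) : qnorm (imag x y z) = ((x ^ 2 + y ^ 2 + z ^ 2 : ℤ) : ℚ) := by
  simp [qnorm]

theorem imag_mul_self (x y z : ℤ) :
    imag x y z * imag x y z = -((x ^ 2 + y ^ 2 + z ^ 2 : ℤ) : 𝔻) := by
  ext <;> simp [-Int.cast_add, -Int.cast_pow] <;> ring

theorem exists_imag_of_re_eq {α β : 𝔻} (hα : α ∈ Hur) (hβ : β ∈ Hur) (h : α.re = β.re) :
    ∃ x y z : ℤ, α - β = imag x y z := by
  have hm : α - β ∈ Hur := hurwitz.sub_mem hα hβ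
  obtain ⟨x, y, z, hx, hy, hz⟩ := exists_int_coords_of_re_eq_zero hm (by simp [h])
  refine ⟨x, y, z, ?_⟩
  ext
  · simp [h]
  · exact hx
  · exact hy
  · exact hz

theorem exists_re_qnorm_of_subset_classOf {S R : Set 𝔻} {m : Polynomial ℤ} (hm : m.Monic)
    (hdeg : m.natDegree = 2) (hS : S ⊆ classOf R m) :
    ∃ r n : ℚ, ∀ α ∈ S, α.re = r ∧ qnorm α = n := by
  refine ⟨-(m.coeff 1 : ℚ) / 2, m.coeff 0, fun α hα => ?_⟩
  have h := (hS hα).2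
  unfold minPoly at h
  split_ifs at h with h0
  · have := congrArg natDegree h
    rw [natDegree_X_sub_C, hm.natDegree_map, hdeg] at this
    omega
  · have h1 := congrArg (fun p => coeff p 1) h
    have h2 := congrArg (fun p => coeff p 0) h
    simp [-map_mul, coeff_X, coeff_C, coeff_X_pow] at h1 h2
    exact ⟨by linarith, h2⟩

theorem sq_eq (α : 𝔻) : α * α = (2 * α.re) • α - qnorm α • (1 : 𝔻) := by
  ext <;> simp [qnorm] <;> ring

theorem exists_pow_eq_linear {S : Set 𝔻} {r n : ℚ} (h : ∀ α ∈ S, α.re = r ∧ qnorm α = n) (k : ℕ) :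
    ∃ s t : ℚ, ∀ α ∈ S, α ^ k = s • α + t • (1 : 𝔻) := by
  induction k with
  | zero => exact ⟨0, 1, by simp⟩
  | succ k ih =>
    obtain ⟨s, t, hst⟩ := ih
    refine ⟨s * (2 * r) + t, -(s * n), fun α hα => ?_⟩
    rw [pow_succ, hst α hα, add_mul, smul_mul_assoc, sq_eq, (h α hα).1, (h α hα).2,
      smul_mul_assoc, one_mul]
    module

/-- On a set of quaternions with common trace and norm, every polynomial acts as a linear one. -/
theorem exists_linear_eval {S : Set 𝔻} {r n : ℚ} (h : ∀ α ∈ S, α.re = r ∧ qnorm α = n)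
    (f : 𝔻[X]) :
    ∃ a b : 𝔻, ∀ α ∈ S, ∀ γ : 𝔻, (f * C γ).eval α = a * γ * α + b * γ := by
  induction f using Polynomial.induction_on' with
  | add p q hp hq =>
    obtain ⟨a, b, hab⟩ := hp
    obtain ⟨a', b', hab'⟩ := hq
    refine ⟨a + a', b + b', fun α hα γ => ?_⟩
    rw [add_mul, eval_add, hab α hα, hab' α hα]
    noncomm_ring
  | monomial k c =>
    obtain ⟨s, t, hst⟩ := exists_pow_eq_linear h k
    refine ⟨s • c, t • c, fun α hα γ => ?_⟩
    rw [monomial_mul_C, eval_monomial, hst α hα, mul_add, mul_smul_comm, mul_smul_comm, mul_one,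
      smul_mul_assoc, smul_mul_assoc, smul_mul_assoc]

theorem eval_mul_eq_eval_mul_C_eval (f g : 𝔻[X]) (α : 𝔻) :
    (f * g).eval α = (f * C (g.eval α)).eval α := by
  induction f using Polynomial.induction_on' with
  | add p q hp hq => simp only [add_mul, eval_add, hp, hq]
  | monomial k c =>
    rw [monomial_mul_C, eval_monomial, ← C_mul_X_pow_eq_monomial, mul_assoc,
      X_pow_mul, eval_C_mul, eval_mul_X_pow, mul_assoc]

theorem gam_spec_s1 {S : Set 𝔻} (h : ∃ t ∈ normsOf S, t ≠ 0) :
    gam S ≠ 0 ∧ (gam S : ℤ) ∈ Ideal.span (normsOf S) ∧ ∀ t ∈ normsOf S, (gam S : ℤ) ∣ t := by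
  set I := Ideal.span (normsOf S)
  obtain ⟨d, hd⟩ := (IsPrincipalIdealRing.principal I).principal
  have hdvd : ∀ c : ℤ, (∀ t ∈ normsOf S, c ∣ t) ↔ c ∣ d := by
    intro c
    rw [← Ideal.span_singleton_le_span_singleton, Ideal.span, ← hd, Ideal.span_le]
    simp only [Set.subset_def, SetLike.mem_coe, Ideal.mem_span_singleton]
  have hd0 : d ≠ 0 := by
    rintro rfl
    obtain ⟨t, ht, ht0⟩ := h
    exact ht0 (zero_dvd_iff.1 ((hdvd 0).2 dvd_rfl t ht))
  have hg : gam S = d.natAbs := by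
    have : {g : ℕ | ∀ t ∈ normsOf S, (g : ℤ) ∣ t} = {g : ℕ | g ∣ d.natAbs} := by
      ext g
      change (∀ t ∈ normsOf S, (g : ℤ) ∣ t) ↔ g ∣ d.natAbs
      rw [hdvd, Int.natCast_dvd]
    rw [gam, this]
    refine IsGreatest.csSup_eq ⟨dvd_rfl, fun g hg => ?_⟩
    exact Nat.le_of_dvd (Int.natAbs_pos.2 hd0) hg
  refine ⟨by simpa [hg], ?_, ?_⟩
  · have : d ∈ I := by rw [hd]; exact Submodule.mem_span_singleton_self d
    rw [hg]
    rcases Int.natAbs_eq d with h | h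
    · rwa [← h]
    · rw [← neg_neg ((d.natAbs : ℕ) : ℤ), ← h]; exact I.neg_mem this
  · rw [hdvd, hg]
    exact Int.natAbs_dvd.2 dvd_rfl

/-- Two orthogonal isotropic vectors of a three-dimensional quadratic space are proportional. -/
theorem cross_eq_zero_of_isotropic_s1 {F : Type*} [Field F] {x y z x' y' z' : F}
    (h : x ^ 2 + y ^ 2 + z ^ 2 = 0) (h' : x' ^ 2 + y' ^ 2 + z' ^ 2 = 0)
    (ho : x * x' + y * y' + z * z' = 0) : y * z' - z * y' = 0 := by
  have e1 : (y * z' - z * y') * y = (z * x' - x * z') * x := by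
    linear_combination z' * h - z * ho
  have e2 : (y * z' - z * y') * z = (x * y' - y * x') * x := by
    linear_combination -y' * h + y * ho
  have e3 : (y * z' - z * y') * y' = (z * x' - x * z') * x' := by
    linear_combination -z * h' + z' * ho
  have e4 : (y * z' - z * y') * z' = (x * y' - y * x') * x' := by
    linear_combination y * h' - y' * ho
  have : (y * z' - z * y') ^ 3 = 0 := by
    linear_combination (y * z' - z * y') * z' * e1 + (z * x' - x * z') * x * e4 -
      (y * z' - z * y') * y' * e2 - (x * y' - y * x') * x * e3
  exact pow_eq_zero_iff (by norm_num) |>.1 this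

theorem IsRingset.mul_commutator_mem {S : Set 𝔻} (h : IsRingset S Hur) {a : 𝔻}
    (ha : ∀ α ∈ S, ∀ β ∈ S, a * (α - β) ∈ Hur) {γ : 𝔻} (hγ : γ ∈ Hur) {α : 𝔻} (hα : α ∈ S) :
    a * (γ * α - α * γ) ∈ Hur := by
  have hf : C a * X - C (a * α) ∈ IntPolys S Hur := fun β hβ => by
    simpa [mul_sub] using ha β hβ α hα
  have hg : C γ ∈ IntPolys S Hur := fun β _ => by simpa using hγ
  have := h _ hf _ hg α hα
  rwa [sub_mul, mul_assoc, X_mul_C, ← C_mul, ← mul_assoc, ← C_mul, eval_sub, eval_C,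
    eval_C_mul, eval_X, mul_assoc, mul_assoc, ← mul_sub] at this

theorem isRingset_of_mul_commutator_mem {S : Set 𝔻} {r n : ℚ}
    (hS : ∀ α ∈ S, α.re = r ∧ qnorm α = n)
    (h : ∀ a : 𝔻, (∀ α ∈ S, ∀ β ∈ S, a * (α - β) ∈ Hur) →
      ∀ γ ∈ Hur, ∀ α ∈ S, a * (γ * α - α * γ) ∈ Hur) : IsRingset S Hur := by
  intro f hf g hg α hα
  obtain ⟨a, b, hab⟩ := exists_linear_eval hS f
  have hf' : ∀ β ∈ S, f.eval β = a * β + b := fun β hβ => by simpa using hab β hβ 1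
  have ha : ∀ α ∈ S, ∀ β ∈ S, a * (α - β) ∈ Hur := fun α hα β hβ => by
    have := hurwitz.sub_mem (hf α hα) (hf β hβ)
    rwa [hf' α hα, hf' β hβ, add_sub_add_right_eq_sub, ← mul_sub] at this
  have : _ ∈ Hur :=
    hurwitz.add_mem (h a ha _ (hg α hα) α hα) (mul_mem_Hur (hf α hα) (hg α hα))
  rw [eval_mul_eq_eval_mul_C_eval, hab α hα]
  rw [hf' α hα] at this
  convert this using 1
  noncomm_ring

theorem mul_gam_mem_Hur {S : Set 𝔻} {r : ℚ} (hH : S ⊆ Hur) (hr : ∀ α ∈ S, α.re = r)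
    (h0 : ∃ t ∈ normsOf S, t ≠ 0) {a : 𝔻} (ha : ∀ α ∈ S, ∀ β ∈ S, a * (α - β) ∈ Hur) :
    a * ((gam S : ℤ) : 𝔻) ∈ Hur := by
  have key : ∀ t ∈ Ideal.span (normsOf S), a * (t : 𝔻) ∈ hurwitz := by
    intro t ht
    induction ht using Submodule.span_induction with
    | mem t ht =>
      obtain ⟨_, ⟨α, hα, β, hβ, rfl⟩, ht⟩ := ht
      obtain ⟨x, y, z, h⟩ := exists_imag_of_re_eq (hH hα) (hH hβ) ((hr α hα).trans (hr β hβ).symm)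
      rw [h, qnorm_imag, Int.cast_inj] at ht
      have hm := ha α hα β hβ
      rw [h] at hm
      have := hurwitz.neg_mem (mul_mem_Hur hm (imag_mem_Hur x y z))
      rwa [mul_assoc, imag_mul_self, mul_neg, neg_neg, ← ht] at this
    | zero => simp
    | add s t _ _ hs ht => rw [Int.cast_add, mul_add]; exact hurwitz.add_mem hs ht
    | smul c t _ ht =>
      rw [smul_eq_mul, mul_comm, Int.cast_mul, ← mul_assoc]
      exact hurwitz.mul_mem ht (intCast_mem hurwitz c)
  exact key _ (gam_spec_s1 h0).2.1

theorem exists_mem_normsOf_ne_zero {S : Set 𝔻} {r : ℚ} (hH : S ⊆ Hur) (hr : ∀ α ∈ S, α.re = r)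
    (hS : S.Nontrivial) : ∃ t ∈ normsOf S, t ≠ 0 := by
  obtain ⟨α, hα, β, hβ, hne⟩ := hS
  obtain ⟨x, y, z, h⟩ := exists_imag_of_re_eq (hH hα) (hH hβ) ((hr α hα).trans (hr β hβ).symm)
  refine ⟨x ^ 2 + y ^ 2 + z ^ 2, ⟨α - β, ⟨α, hα, β, hβ, rfl⟩, by rw [h, qnorm_imag]⟩, fun h0 => ?_⟩
  have hx : x = 0 := by nlinarith [sq_nonneg x, sq_nonneg y, sq_nonneg z]
  have hy : y = 0 := by nlinarith [sq_nonneg x, sq_nonneg y, sq_nonneg z]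
  have hz : z = 0 := by nlinarith [sq_nonneg x, sq_nonneg y, sq_nonneg z]
  subst hx hy hz
  refine hne (sub_eq_zero.1 (h.trans ?_))
  ext <;> simp <;> rfl

/-- A commutator of Hurwitz quaternions is imaginary, integral, and has even coordinate sum. -/
theorem exists_imag_eq_commutator {γ α : 𝔻} (hγ : γ ∈ Hur) (hα : α ∈ Hur) :
    ∃ u v w : ℤ, γ * α - α * γ = imag u v w ∧ 2 ∣ u + v + w := by
  rw [mem_Hur_iff] at hγ hα
  obtain ⟨t, b, c, d, h0, h1, h2, h3⟩ := hγ
  obtain ⟨t', b', c', d', h0', h1', h2', h3'⟩ := hα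
  refine ⟨t * (d' - c') + t' * (c - d) + 2 * (c * d' - d * c'),
    t * (b' - d') + t' * (d - b) + 2 * (d * b' - b * d'),
    t * (c' - b') + t' * (b - c) + 2 * (b * c' - c * b'), ?_,
    c * d' - d * c' + (d * b' - b * d') + (b * c' - c * b'), by ring⟩
  ext <;> simp [*] <;> ring

theorem exists_imag_mul_imag_eq_two_mul {x y z x' y' z' : ℤ} (h : 2 ∣ x + y + z)
    (h' : 2 ∣ x' + y' + z') : ∃ q ∈ Hur, imag x y z * imag x' y' z' = 2 * q := by
  obtain ⟨s, hs⟩ := h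
  obtain ⟨s', hs'⟩ := h'
  obtain rfl : z = 2 * s - x - y := by linarith
  obtain rfl : z' = 2 * s' - x' - y' := by linarith
  let e := x * y' + x * x' + y * y' + 2 * s * s' - s * (x' + y') - s' * (x + y)
  let t := -(x * x' + y * y' + (2 * s - x - y) * (2 * s' - x' - y'))
  refine ⟨quat (t / 2) (t / 2 + ((y * s' - s * y' + e : ℤ) : ℚ))
    (t / 2 + ((s * x' - x * s' + e : ℤ) : ℚ)) (t / 2 + (e : ℚ)),
    mem_Hur_iff.2 ⟨t, _, _, _, rfl, rfl, rfl, rfl⟩, Eq.trans ?_ (two_mul _).symm⟩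
  ext <;> simp [t, e] <;> ring

theorem isRingset_of_gam {S : Set 𝔻} {r n : ℚ} (hH : S ⊆ Hur)
    (hS : ∀ α ∈ S, α.re = r ∧ qnorm α = n) (hnt : S.Nontrivial) (hg : gam S = 1 ∨ gam S = 2) :
    IsRingset S Hur := by
  have hr : ∀ α ∈ S, α.re = r := fun α hα => (hS α hα).1
  have h0 := exists_mem_normsOf_ne_zero hH hr hnt
  refine isRingset_of_mul_commutator_mem hS fun a ha γ hγ α hα => ?_
  have hm := mul_gam_mem_Hur hH hr h0 ha
  obtain ⟨u, v, w, he, hev⟩ := exists_imag_eq_commutator hγ (hH hα)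
  rw [he]
  rcases hg with hg | hg
  · rw [hg] at hm
    exact mul_mem_Hur (by simpa using hm) (imag_mem_Hur u v w)
  obtain ⟨-, hspan, hdvd⟩ := gam_spec_s1 h0
  rw [hg] at hm hspan hdvd
  obtain ⟨t, ht, ht4⟩ : ∃ t ∈ normsOf S, ¬ (4 : ℤ) ∣ t := by
    by_contra! hc
    have : Ideal.span (normsOf S) ≤ Ideal.span {(4 : ℤ)} :=
      Ideal.span_le.2 fun t ht => Ideal.mem_span_singleton.2 (hc t ht)
    have := Ideal.mem_span_singleton.1 (this hspan)
    norm_num at this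
  obtain ⟨M, hM⟩ := hdvd t ht
  obtain ⟨_, ⟨β, hβ, β', hβ', rfl⟩, ht⟩ := ht
  obtain ⟨x, y, z, h⟩ := exists_imag_of_re_eq (hH hβ) (hH hβ') ((hr β hβ).trans (hr β' hβ').symm)
  rw [h, qnorm_imag, Int.cast_inj] at ht
  have hδ := ha β hβ β' hβ'
  rw [h] at hδ
  push_cast at hM
  obtain ⟨k, rfl⟩ : Odd M := by
    rw [← Int.not_even_iff_odd]
    rintro ⟨k, rfl⟩
    exact ht4 ⟨k, by rw [hM]; ring⟩
  have hsum : 2 ∣ x + y + z := by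
    have : Even (x ^ 2 + y ^ 2 + z ^ 2) := ⟨2 * k + 1, by rw [← ht, hM]; ring⟩
    rw [← even_iff_two_dvd]
    simpa [Int.even_add, Int.even_pow] using this
  obtain ⟨q, hq, hqe⟩ := exists_imag_mul_imag_eq_two_mul hsum hev
  have hδq : imag x y z * q = -((2 * k + 1 : ℤ) : 𝔻) * imag u v w := by
    have h2 : (2 : 𝔻) * (imag x y z * q) = 2 * (-((2 * k + 1 : ℤ) : 𝔻) * imag u v w) := by
      rw [← mul_assoc, ← Nat.cast_two, Nat.cast_comm, mul_assoc, Nat.cast_two, ← hqe, ← mul_assoc,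
        imag_mul_self, ← ht, hM]
      push_cast
      noncomm_ring
    have := algebraRat.charZero 𝔻
    exact mul_left_cancel₀ two_ne_zero h2
  have h1 := mul_mem_Hur hδ hq
  rw [mul_assoc, hδq] at h1
  have h2 := mul_mem_Hur hm (mul_mem_Hur (intCast_mem hurwitz k) (imag_mem_Hur u v w))
  have h3 : _ ∈ Hur := hurwitz.sub_mem (hurwitz.neg_mem h1) h2
  convert h3 using 1
  push_cast
  noncomm_ring

/-- Reading off the coordinates of a scaled integral quaternion. -/
theorem dvd_of_inv_smul_imag_mem {n : ℤ} (hn : n ≠ 0) {x y z : ℤ}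
    (h : (n : ℚ)⁻¹ • imag x y z ∈ Hur) : n ∣ x ∧ n ∣ y ∧ n ∣ z := by
  obtain ⟨b, c, d, hb, hc, hd⟩ := exists_int_coords_of_re_eq_zero h (by simp)
  have hn' : (n : ℚ) ≠ 0 := by exact_mod_cast hn
  simp at hb hc hd
  rw [inv_mul_eq_iff_eq_mul₀ hn'] at hb hc hd
  exact ⟨⟨b, by exact_mod_cast hb⟩, ⟨c, by exact_mod_cast hc⟩, ⟨d, by exact_mod_cast hd⟩⟩

theorem inv_smul_imag_mem {n : ℤ} (hn : n ≠ 0) {x y z : ℤ} (hx : n ∣ x) (hy : n ∣ y)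
    (hz : n ∣ z) : (n : ℚ)⁻¹ • imag x y z ∈ Hur := by
  obtain ⟨x, rfl⟩ := hx
  obtain ⟨y, rfl⟩ := hy
  obtain ⟨z, rfl⟩ := hz
  have hn' : (n : ℚ) ≠ 0 := by exact_mod_cast hn
  convert imag_mem_Hur x y z using 1
  ext <;> simp [hn']

theorem inv_smul_imag_mul_imag_mem {p : ℕ} (hp : p.Prime) (h2 : p ≠ 2) {x y z x' y' z' : ℤ}
    (h : (p : ℤ) ∣ x ^ 2 + y ^ 2 + z ^ 2) (h' : (p : ℤ) ∣ x' ^ 2 + y' ^ 2 + z' ^ 2)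
    (hd : (p : ℤ) ∣ (x - x') ^ 2 + (y - y') ^ 2 + (z - z') ^ 2) :
    ((p : ℤ) : ℚ)⁻¹ • (imag x y z * imag x' y' z') ∈ Hur := by
  have := Fact.mk hp
  have hp2 : ((2 : ℤ) : ZMod p) ≠ 0 := by
    rw [Ne, ZMod.intCast_zmod_eq_zero_iff_dvd]
    exact fun hdvd => h2 ((Nat.prime_dvd_prime_iff_eq hp Nat.prime_two).1 (by exact_mod_cast hdvd))
  have ho : (p : ℤ) ∣ x * x' + y * y' + z * z' := by
    rw [← ZMod.intCast_zmod_eq_zero_iff_dvd] at h h' hd ⊢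
    push_cast at *
    refine (mul_eq_zero.1 ?_).resolve_left hp2
    linear_combination h + h' - hd
  have hc : (p : ℤ) ∣ y * z' - z * y' ∧ (p : ℤ) ∣ z * x' - x * z' ∧ (p : ℤ) ∣ x * y' - y * x' := by
    rw [← ZMod.intCast_zmod_eq_zero_iff_dvd] at h h' ho
    simp only [← ZMod.intCast_zmod_eq_zero_iff_dvd]
    push_cast at *
    refine ⟨cross_eq_zero_of_isotropic_s1 h h' ho, ?_, ?_⟩
    · refine cross_eq_zero_of_isotropic_s1 (x := (y : ZMod p)) (x' := y') ?_ ?_ ?_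
      · linear_combination h
      · linear_combination h'
      · linear_combination ho
    · refine cross_eq_zero_of_isotropic_s1 (x := (z : ZMod p)) (x' := z') ?_ ?_ ?_
      · linear_combination h
      · linear_combination h'
      · linear_combination ho
  obtain ⟨s, hs⟩ := ho
  have hpQ : (p : ℚ) ≠ 0 := by exact_mod_cast hp.ne_zero
  have hsQ : (x * x' + y * y' + z * z' : ℚ) = p * s := by exact_mod_cast hs
  have hm : _ ∈ Hur := hurwitz.sub_mem
    (inv_smul_imag_mem (by exact_mod_cast hp.ne_zero) hc.1 hc.2.1 hc.2.2) (intCast_mem hurwitz s)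
  convert hm using 1
  ext <;> simp
  · field_simp
    linear_combination -hsQ
  · exact Or.inl (by ring)

theorem dvd_coords_of_isotropic {S : Set 𝔻} {r : ℚ} (hH : S ⊆ Hur) (hr : ∀ α ∈ S, α.re = r)
    (h : IsRingset S Hur) {p : ℕ} (hp : p.Prime) (h2 : p ≠ 2)
    (hdvd : ∀ t ∈ normsOf S, (p : ℤ) ∣ t) {α β : 𝔻} (hα : α ∈ S) (hβ : β ∈ S) {x y z : ℤ}
    (hδ : α - β = imag x y z) : (p : ℤ) ∣ x ∧ (p : ℤ) ∣ y ∧ (p : ℤ) ∣ z := by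
  have hN : ∀ α' ∈ S, ∀ β' ∈ S, ∀ x y z : ℤ, α' - β' = imag x y z →
      (p : ℤ) ∣ x ^ 2 + y ^ 2 + z ^ 2 := fun α' hα' β' hβ' x y z he =>
    hdvd _ ⟨α' - β', ⟨α', hα', β', hβ', rfl⟩, by rw [he, qnorm_imag]⟩
  have hbase : ∀ α' ∈ S, (((p : ℤ) : ℚ)⁻¹ • imag x y z) * (α' - β) ∈ Hur := by
    intro α' hα'
    obtain ⟨x', y', z', he⟩ := exists_imag_of_re_eq (hH hα') (hH hβ)
      ((hr α' hα').trans (hr β hβ).symm)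
    rw [he, smul_mul_assoc]
    refine inv_smul_imag_mul_imag_mem hp h2 (hN _ hα _ hβ _ _ _ hδ) (hN _ hα' _ hβ _ _ _ he)
      (hN _ hα _ hα' _ _ _ ?_)
    rw [← sub_sub_sub_cancel_right α α' β, hδ, he]
    ext <;> simp
  have ha : ∀ α' ∈ S, ∀ β' ∈ S, (((p : ℤ) : ℚ)⁻¹ • imag x y z) * (α' - β') ∈ Hur := by
    intro α' hα' β' hβ'
    have : _ ∈ Hur := hurwitz.sub_mem (hbase α' hα') (hbase β' hβ')
    rwa [← mul_sub, sub_sub_sub_cancel_right] at this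
  have hp0 : (p : ℤ) ≠ 0 := by exact_mod_cast hp.ne_zero
  have hcop : IsCoprime (p : ℤ) 2 :=
    Nat.isCoprime_iff_coprime.2 ((Nat.coprime_primes hp Nat.prime_two).2 h2)
  have hpN := hN _ hα _ hβ _ _ _ hδ
  have hcomm : ∀ u v w : ℤ, (((p : ℤ) : ℚ)⁻¹ •
      imag (2 * (x ^ 2 + y ^ 2 + z ^ 2) * u - 2 * (x * u + y * v + z * w) * x)
        (2 * (x ^ 2 + y ^ 2 + z ^ 2) * v - 2 * (x * u + y * v + z * w) * y)
        (2 * (x ^ 2 + y ^ 2 + z ^ 2) * w - 2 * (x * u + y * v + z * w) * z)) ∈ Hur := by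
    intro u v w
    have hm : _ ∈ Hur := hurwitz.sub_mem (h.mul_commutator_mem ha (imag_mem_Hur u v w) hα)
      (h.mul_commutator_mem ha (imag_mem_Hur u v w) hβ)
    rw [← mul_sub, sub_sub_sub_comm, ← mul_sub, ← sub_mul, hδ, smul_mul_assoc] at hm
    convert hm using 2
    ext <;> simp <;> ring
  have hsq : ∀ c : ℤ, (p : ℤ) ∣ 2 * (x ^ 2 + y ^ 2 + z ^ 2) - 2 * c ^ 2 → (p : ℤ) ∣ c := by
    intro c hc
    have h1 : (p : ℤ) ∣ 2 * c ^ 2 := (Int.dvd_iff_dvd_of_dvd_sub hc).1 (hpN.mul_left 2)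
    exact (Nat.prime_iff_prime_int.1 hp).dvd_of_dvd_pow (hcop.dvd_of_dvd_mul_left h1)
  refine ⟨hsq x ?_, hsq y ?_, hsq z ?_⟩
  · convert (dvd_of_inv_smul_imag_mem hp0 (hcomm 1 0 0)).1 using 1; ring
  · convert (dvd_of_inv_smul_imag_mem hp0 (hcomm 0 1 0)).2.1 using 1; ring
  · convert (dvd_of_inv_smul_imag_mem hp0 (hcomm 0 0 1)).2.2 using 1; ring

theorem inv_smul_commutator_mem {S : Set 𝔻} {r : ℚ} (hH : S ⊆ Hur) (hr : ∀ α ∈ S, α.re = r)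
    (h : IsRingset S Hur) {n : ℤ} (hn : n ≠ 0)
    (hdvd : ∀ α ∈ S, ∀ β ∈ S, ∀ x y z : ℤ, α - β = imag x y z → n ∣ x ∧ n ∣ y ∧ n ∣ z)
    {γ : 𝔻} (hγ : γ ∈ Hur) {α : 𝔻} (hα : α ∈ S) : (n : ℚ)⁻¹ • (γ * α - α * γ) ∈ Hur := by
  have := h.mul_commutator_mem (a := (n : ℚ)⁻¹ • (1 : 𝔻)) (fun α hα β hβ => ?_) hγ hα
  · rwa [smul_mul_assoc, one_mul] at this
  obtain ⟨x, y, z, he⟩ := exists_imag_of_re_eq (hH hα) (hH hβ) ((hr α hα).trans (hr β hβ).symm)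
  obtain ⟨hx, hy, hz⟩ := hdvd α hα β hβ x y z he
  rw [smul_mul_assoc, one_mul, he]
  exact inv_smul_imag_mem hn hx hy hz

theorem not_isRingset_of_odd_prime_dvd {S : Set 𝔻} {r : ℚ} (hH : S ⊆ Hur)
    (hr : ∀ α ∈ S, α.re = r) (hne : S.Nonempty)
    (hred : ∀ a n : ℤ, 2 ≤ n → ¬ (transSet S a ⊆ scaleSet n Hur)) {p : ℕ} (hp : p.Prime)
    (h2 : p ≠ 2) (hdvd : ∀ t ∈ normsOf S, (p : ℤ) ∣ t) : ¬ IsRingset S Hur := by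
  intro h
  have hp0 : (p : ℤ) ≠ 0 := by exact_mod_cast hp.ne_zero
  have hcomm := fun {γ} hγ {α} hα => inv_smul_commutator_mem hH hr h hp0
    (fun α hα β hβ x y z he => dvd_coords_of_isotropic hH hr h hp h2 hdvd hα hβ he)
    (γ := γ) hγ (α := α) hα
  obtain ⟨α₀, hα₀⟩ := hne
  obtain ⟨t, -, -, -, h0, -, -, -⟩ := mem_Hur_iff.1 (hH hα₀)
  rw [hr α₀ hα₀] at h0
  obtain ⟨m, hm⟩ := hp.odd_of_ne_two h2
  have hpm : (p : ℤ) = 2 * m + 1 := by exact_mod_cast hm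
  have hcoord : ∀ b : ℤ, (p : ℤ) ∣ t + 2 * b → ∃ e : ℤ, t + 2 * b = p * (t + 2 * e) := by
    rintro b ⟨s, hs⟩
    refine ⟨b - m * s, ?_⟩
    rw [hs]
    linear_combination -(p : ℤ) * hs - p * s * hpm
  refine hred (m * t) p (by exact_mod_cast hp.two_le) ?_
  rintro _ ⟨α, hα, rfl⟩
  obtain ⟨t', b, c, d, h0', h1, h2, h3⟩ := mem_Hur_iff.1 (hH hα)
  obtain rfl : t' = t := by
    have : (t' : ℚ) / 2 = t / 2 := by rw [← h0', hr α hα, h0]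
    exact_mod_cast (div_left_inj' two_ne_zero).1 this
  have hi : (p : ℤ) ∣ 0 ∧ (p : ℤ) ∣ -(t' + 2 * d) ∧ (p : ℤ) ∣ t' + 2 * c := by
    refine dvd_of_inv_smul_imag_mem hp0 ?_
    convert hcomm (imag_mem_Hur 1 0 0) hα using 2
    ext <;> simp [h0', h1, h2, h3] <;> ring
  have hj : (p : ℤ) ∣ t' + 2 * d ∧ (p : ℤ) ∣ 0 ∧ (p : ℤ) ∣ -(t' + 2 * b) := by
    refine dvd_of_inv_smul_imag_mem hp0 ?_
    convert hcomm (imag_mem_Hur 0 1 0) hα using 2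
    ext <;> simp [h0', h1, h2, h3] <;> ring
  obtain ⟨b', hb⟩ := hcoord b (dvd_neg.1 hj.2.2)
  obtain ⟨c', hc⟩ := hcoord c hi.2.2
  obtain ⟨d', hd⟩ := hcoord d hj.1
  refine ⟨quat (t' / 2) (t' / 2 + b') (t' / 2 + c') (t' / 2 + d'),
    mem_Hur_iff.2 ⟨t', b', c', d', rfl, rfl, rfl, rfl⟩, ?_⟩
  have hpQ : (p : ℚ) = 2 * m + 1 := by exact_mod_cast hm
  have hbQ : (t' + 2 * b : ℚ) = p * (t' + 2 * b') := by exact_mod_cast hb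
  have hcQ : (t' + 2 * c : ℚ) = p * (t' + 2 * c') := by exact_mod_cast hc
  have hdQ : (t' + 2 * d : ℚ) = p * (t' + 2 * d') := by exact_mod_cast hd
  ext <;> simp [h0', h1, h2, h3]
  · linear_combination t' / 2 * hpQ
  · linear_combination -hbQ / 2
  · linear_combination -hcQ / 2
  · linear_combination -hdQ / 2

theorem not_isRingset_of_four_dvd {S : Set 𝔻} {r : ℚ} (hH : S ⊆ Hur)
    (hr : ∀ α ∈ S, α.re = r) (hne : S.Nonempty)
    (hred : ∀ a n : ℤ, 2 ≤ n → ¬ (transSet S a ⊆ scaleSet n Hur))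
    (hdvd : ∀ t ∈ normsOf S, (4 : ℤ) ∣ t) : ¬ IsRingset S Hur := by
  intro h
  have hdiff : ∀ α ∈ S, ∀ β ∈ S, ∀ x y z : ℤ, α - β = imag x y z →
      (2 : ℤ) ∣ x ∧ (2 : ℤ) ∣ y ∧ (2 : ℤ) ∣ z := by
    intro α hα β hβ x y z he
    have h4 := hdvd (x ^ 2 + y ^ 2 + z ^ 2)
      ⟨α - β, ⟨α, hα, β, hβ, rfl⟩, by rw [he, qnorm_imag]⟩
    have hz : ((x ^ 2 + y ^ 2 + z ^ 2 : ℤ) : ZMod 4) = 0 :=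
      (ZMod.intCast_zmod_eq_zero_iff_dvd _ 4).2 h4
    have hsq : ∀ c : ℤ, c ^ 2 % 4 = 0 ∧ 2 ∣ c ∨ c ^ 2 % 4 = 1 := by
      intro c
      obtain ⟨k, rfl | rfl⟩ := Int.even_or_odd' c
      · exact Or.inl ⟨by ring_nf; omega, dvd_mul_right _ _⟩
      · exact Or.inr (by ring_nf; omega)
    have hx := hsq x
    have hy := hsq y
    have hz := hsq z
    omega
  have hcomm := fun {γ} hγ {α} hα =>
    inv_smul_commutator_mem hH hr h two_ne_zero hdiff (γ := γ) hγ (α := α) hα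
  have hform : ∀ α ∈ S, ∃ s b c d : ℤ, α.re = s ∧ α.imI = s + b ∧ α.imJ = s + c ∧
      α.imK = s + d ∧ 2 ∣ d - b ∧ 2 ∣ d - c := by
    intro α hα
    obtain ⟨t, b, c, d, h0, h1, h2, h3⟩ := mem_Hur_iff.1 (hH hα)
    have hi : (2 : ℤ) ∣ 0 ∧ (2 : ℤ) ∣ -(t + 2 * d) ∧ (2 : ℤ) ∣ t + 2 * c := by
      refine dvd_of_inv_smul_imag_mem two_ne_zero ?_
      convert hcomm (imag_mem_Hur 1 0 0) hα using 2
      ext <;> simp [h0, h1, h2, h3] <;> ring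
    have hh : (2 : ℤ) ∣ d - c ∧ (2 : ℤ) ∣ b - d ∧ (2 : ℤ) ∣ c - b := by
      refine dvd_of_inv_smul_imag_mem two_ne_zero ?_
      convert hcomm (γ := quat (1 / 2) (1 / 2) (1 / 2) (1 / 2))
        (mem_Hur_iff.2 ⟨1, 0, 0, 0, by simp⟩) hα using 2
      ext <;> simp [h0, h1, h2, h3] <;> ring
    obtain ⟨s, rfl⟩ : (2 : ℤ) ∣ t := by omega
    refine ⟨s, b, c, d, ?_, ?_, ?_, ?_, by omega, hh.1⟩ <;> simp [h0, h1, h2, h3]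
  obtain ⟨α₀, hα₀⟩ := hne
  obtain ⟨s, b₀, c₀, d₀, h0, h1, h2, h3, -, -⟩ := hform α₀ hα₀
  refine hred d₀ 2 le_rfl ?_
  rintro _ ⟨α, hα, rfl⟩
  obtain ⟨s', b, c, d, h0', h1', h2', h3', hdb, hdc⟩ := hform α hα
  obtain rfl : s' = s := by
    have : (s' : ℚ) = s := by rw [← h0', ← h0, hr α hα, hr α₀ hα₀]
    exact_mod_cast this
  have hd := (hdiff α hα α₀ hα₀ (b - b₀) (c - c₀) (d - d₀) (by ext <;> simp [*])).2.2
  obtain ⟨B, hB⟩ : (2 : ℤ) ∣ b - d₀ := by omega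
  obtain ⟨C, hC⟩ : (2 : ℤ) ∣ c - d₀ := by omega
  obtain ⟨D, hD⟩ := hd
  obtain rfl := eq_add_of_sub_eq hB
  obtain rfl := eq_add_of_sub_eq hC
  obtain rfl := eq_add_of_sub_eq hD
  let t := s' + d₀
  refine ⟨quat (t / 2) (t / 2 + B) (t / 2 + C) (t / 2 + D),
    mem_Hur_iff.2 ⟨t, B, C, D, rfl, rfl, rfl, rfl⟩, ?_⟩
  ext <;> simp [-Int.cast_ofNat, h0', h1', h2', h3', t] <;> ring

/-- Theorem (main, Hurwitz case): classification of reduced ringsets of H. -/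
theorem stmt_1 (S : Set 𝔻) (hsub : S ⊂ Hur) (hred : IsReducedIn S Hur)
    (hcard : S.Nontrivial) :
    IsRingset S Hur ↔ (gam S = 1 ∨ gam S = 2) := by
  obtain ⟨⟨m, hm, hdeg, hSm⟩, hred⟩ := hred
  obtain ⟨r, n, hS⟩ := exists_re_qnorm_of_subset_classOf hm hdeg hSm
  have hH := hsub.subset
  have hr : ∀ α ∈ S, α.re = r := fun α hα => (hS α hα).1
  refine ⟨fun h => ?_, isRingset_of_gam hH hS hcard⟩
  obtain ⟨hg0, -, hdvd⟩ := gam_spec_s1 (exists_mem_normsOf_ne_zero hH hr hcard)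
  by_contra! hg
  rcases Nat.four_dvd_or_exists_odd_prime_and_dvd_of_two_lt (n := gam S) (by omega) with
    h4 | ⟨p, hp, hpg, hodd⟩
  · exact not_isRingset_of_four_dvd hH hr hcard.nonempty hred
      (fun t ht => dvd_trans (by exact_mod_cast h4) (hdvd t ht)) h
  · refine not_isRingset_of_odd_prime_dvd hH hr hcard.nonempty hred hp ?_
      (fun t ht => dvd_trans (by exact_mod_cast hpg) (hdvd t ht)) h
    rintro rfl
    exact absurd hodd (by decide)
end
end

section
/- Let R be either L or H. Let S ⊆ R be finite and nonempty, let m ∈ ℤ[x] be monic of degree 1 or 2, and let T ⊆ C_R(m) be nonempty with S ∩ C_R(m) = ∅ (i.e., no element of S has minimal polynomial m). Then there exists a polynomial F ∈ ℚ[x] (viewed inside 𝔻[x]) such that F(α) = 0 for all α ∈ S and F(α) = 1 for all α ∈ T. -/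
noncomputable section

open Polynomial

theorem minPoly_monic (α : 𝔻) : (minPoly α).Monic := by
  unfold minPoly
  split_ifs
  · exact monic_X_sub_C _
  · monicity!

theorem minPoly_irreducible (α : 𝔻) : Irreducible (minPoly α) := by
  by_cases h : α.imI = 0 ∧ α.imJ = 0 ∧ α.imK = 0
  · rw [minPoly, if_pos h]
    exact irreducible_X_sub_C _
  · have hdeg : (minPoly α).natDegree = 2 := by
      rw [minPoly, if_neg h]
      compute_degree!
    rw [(minPoly_monic α).irreducible_iff_roots_eq_zero_of_degree_le_three
      (by omega) (by omega), Multiset.eq_zero_iff_forall_notMem]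
    intro q hq
    have hroot := isRoot_of_mem_roots hq
    simp only [minPoly, if_neg h, IsRoot.def, qnorm, eval_add, eval_sub, eval_mul, eval_pow,
      eval_X, eval_C] at hroot
    have hsum : (q - α.re) ^ 2 + α.imI ^ 2 + α.imJ ^ 2 + α.imK ^ 2 = 0 := by linarith
    have h0 := sq_nonneg (q - α.re)
    have h1 := sq_nonneg α.imI
    have h2 := sq_nonneg α.imJ
    have h3 := sq_nonneg α.imK
    exact h ⟨pow_eq_zero_iff two_ne_zero |>.1 (by linarith),
      pow_eq_zero_iff two_ne_zero |>.1 (by linarith),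
      pow_eq_zero_iff two_ne_zero |>.1 (by linarith)⟩

theorem aeval_minPoly (α : 𝔻) : aeval α (minPoly α) = 0 := by
  unfold minPoly
  split_ifs with h
  · obtain ⟨h1, h2, h3⟩ := h
    apply Quaternion.ext <;> change _ = (0 : ℚ) <;> simp [h1, h2, h3]
  · simp only [map_add, map_sub, map_mul, aeval_X, aeval_C, two_mul, sq, qnorm]
    apply Quaternion.ext <;> change _ = (0 : ℚ) <;> simp <;> ring

theorem isCoprime_minPoly {α β : 𝔻} (h : minPoly α ≠ minPoly β) :
    IsCoprime (minPoly α) (minPoly β) := by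
  rw [(minPoly_irreducible α).coprime_iff_not_dvd]
  intro hdvd
  exact h (eq_of_monic_of_associated (minPoly_monic α) (minPoly_monic β)
    ((minPoly_irreducible α).associated_of_dvd (minPoly_irreducible β) hdvd))

/-- Separation of minimal polynomial classes by rational polynomials. -/
theorem stmt_2 (R : Set 𝔻) (hR : R = Lip ∨ R = Hur)
    (S : Set 𝔻) (hSsub : S ⊆ R) (hSfin : S.Finite) (hSne : S.Nonempty)
    (m : Polynomial ℤ) (hm : m.Monic) (hdeg : m.natDegree = 1 ∨ m.natDegree = 2)
    (T : Set 𝔻) (hTsub : T ⊆ classOf R m) (hTne : T.Nonempty)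
    (hdisj : S ∩ classOf R m = ∅) :
    ∃ F : Polynomial ℚ,
      (∀ α ∈ S, (F.map (algebraMap ℚ 𝔻)).eval α = 0) ∧
      (∀ α ∈ T, (F.map (algebraMap ℚ 𝔻)).eval α = 1) := by
  obtain ⟨β, hβ⟩ := hTne
  have hcop : IsCoprime (∏ α ∈ hSfin.toFinset, minPoly α) (minPoly β) := by
    refine IsCoprime.prod_left fun α hα => isCoprime_minPoly fun h => ?_
    have hαS : α ∈ S := hSfin.mem_toFinset.1 hα
    have hmem : α ∈ S ∩ classOf R m := ⟨hαS, hSsub hαS, h.trans (hTsub hβ).2⟩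
    simp [hdisj] at hmem
  obtain ⟨a, b, hab⟩ := hcop
  refine ⟨a * ∏ α ∈ hSfin.toFinset, minPoly α, fun α hα => ?_, fun α hα => ?_⟩
  · rw [eval_map_algebraMap]
    obtain ⟨c, hc⟩ := Finset.dvd_prod_of_mem minPoly (hSfin.mem_toFinset.2 hα)
    rw [hc, map_mul, map_mul, aeval_minPoly, zero_mul, mul_zero]
  · have hmin : minPoly β = minPoly α := (hTsub hβ).2.trans (hTsub hα).2.symm
    rw [eval_map_algebraMap, eq_sub_of_add_eq hab, hmin, map_sub, map_mul, aeval_minPoly,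
      mul_zero, sub_zero, map_one]
end
end

section
/- Let R be either L or H. Let S ⊆ R be finite and nonempty, let m ∈ ℤ[x] be monic of degree 1 or 2, and let T ⊆ C_R(m) be nonempty with S ∩ C_R(m) = ∅. If T is not a ringset of R, then S ∪ T is not a ringset of R. -/
noncomputable section

open Polynomial

theorem isIntegral_quaternion (α : 𝔻) : IsIntegral ℚ α :=
  ⟨minPoly α, minPoly_monic α, aeval_minPoly α⟩

theorem minPoly_eq_minpoly (α : 𝔻) : minPoly α = minpoly ℚ α := by
  refine eq_of_monic_of_dvd_of_natDegree_le (minpoly.monic (isIntegral_quaternion α))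
    (minPoly_monic α) (minpoly.dvd ℚ α (aeval_minPoly α)) ?_
  by_cases h : α.imI = 0 ∧ α.imJ = 0 ∧ α.imK = 0
  · have hd : (minPoly α).natDegree = 1 := by
      rw [minPoly, if_pos h]; compute_degree!
    rw [hd]
    exact minpoly.natDegree_pos (isIntegral_quaternion α)
  · have hd : (minPoly α).natDegree = 2 := by
      rw [minPoly, if_neg h]; compute_degree!
    rw [hd, minpoly.two_le_natDegree_iff (isIntegral_quaternion α)]
    rintro ⟨q, rfl⟩
    exact h (by simp)

/-- Evaluation is multiplicative when the right factor has rational coefficients. -/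
theorem eval_mul_map_rat (f : 𝔻[X]) (h : ℚ[X]) (α : 𝔻) :
    (f * h.map (algebraMap ℚ 𝔻)).eval α = f.eval α * aeval α h := by
  rw [aeval_def, ← eval_map]
  refine eval₂_mul_noncomm (RingHom.id 𝔻) α fun k => ?_
  rw [coeff_map, RingHom.id_apply]
  exact Algebra.commutes (h.coeff k) α

theorem commute_map_rat (f : 𝔻[X]) (h : ℚ[X]) : Commute (h.map (algebraMap ℚ 𝔻)) f := by
  refine Polynomial.ext fun n => ?_
  rw [coeff_mul, coeff_mul, ← Finset.Nat.sum_antidiagonal_swap]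
  refine Finset.sum_congr rfl fun p _ => ?_
  simp only [coeff_map, Prod.fst_swap, Prod.snd_swap]
  exact Algebra.commutes _ _

/-- A rational polynomial vanishing on the finite set `S` and equal to `1` on the whole
minimal polynomial class of `α`. -/
theorem exists_separating_polynomial {S : Set 𝔻} (hS : S.Finite) (α : 𝔻)
    (hα : ∀ β ∈ S, minPoly α ≠ minPoly β) :
    ∃ h : ℚ[X], (∀ β ∈ S, aeval β h = 0) ∧ ∀ τ, minPoly τ = minPoly α → aeval τ h = 1 := by
  obtain ⟨u, v, huv⟩ : IsCoprime (minPoly α) (∏ β ∈ hS.toFinset, minPoly β) :=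
    IsCoprime.prod_right fun β hβ => isCoprime_minPoly (hα β (hS.mem_toFinset.1 hβ))
  refine ⟨v * ∏ β ∈ hS.toFinset, minPoly β, fun β hβ => ?_, fun τ hτ => ?_⟩
  · obtain ⟨w, hw⟩ := Finset.dvd_prod_of_mem minPoly (hS.mem_toFinset.2 hβ)
    rw [hw, mul_left_comm, map_mul, aeval_minPoly, zero_mul]
  · have h := congrArg (aeval τ) huv
    rwa [map_add, map_mul (aeval τ) u, ← hτ, aeval_minPoly, mul_zero, zero_add, map_one] at h

/-- If T (in a minimal polynomial class disjoint from S) is not a ringset,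
then S ∪ T is not a ringset. -/
theorem stmt_3 (R : Set 𝔻) (hR : R = Lip ∨ R = Hur)
    (S : Set 𝔻) (hSsub : S ⊆ R) (hSfin : S.Finite) (hSne : S.Nonempty)
    (m : Polynomial ℤ) (hm : m.Monic) (hdeg : m.natDegree = 1 ∨ m.natDegree = 2)
    (T : Set 𝔻) (hTsub : T ⊆ classOf R m) (hTne : T.Nonempty)
    (hdisj : S ∩ classOf R m = ∅)
    (hT : ¬ IsRingset T R) :
    ¬ IsRingset (S ∪ T) R := by
  intro hST
  apply hT
  have h0 : (0 : 𝔻) ∈ R := by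
    have : (0 : 𝔻) ∈ Lip := ⟨⟨0, Int.cast_zero.symm⟩, ⟨0, Int.cast_zero.symm⟩,
      ⟨0, Int.cast_zero.symm⟩, ⟨0, Int.cast_zero.symm⟩⟩
    rcases hR with rfl | rfl
    · exact this
    · exact Or.inl this
  obtain ⟨α, hαT⟩ := hTne
  obtain ⟨h, hS0, hT1⟩ := exists_separating_polynomial hSfin α fun β hβ he =>
    Set.eq_empty_iff_forall_notMem.1 hdisj β ⟨hβ, hSsub hβ, he ▸ (hTsub hαT).2⟩
  have hT1 : ∀ τ ∈ T, aeval τ h = 1 := fun τ hτ =>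
    hT1 τ ((hTsub hτ).2.trans (hTsub hαT).2.symm)
  have hmem : ∀ f ∈ IntPolys T R, f * h.map (algebraMap ℚ 𝔻) ∈ IntPolys (S ∪ T) R := by
    rintro f hf β (hβ | hβ)
    · rwa [eval_mul_map_rat, hS0 β hβ, mul_zero]
    · rw [eval_mul_map_rat, hT1 β hβ, mul_one]
      exact hf β hβ
  intro f hf g hg τ hτ
  have key := hST _ (hmem f hf) _ (hmem g hg) τ (Or.inr hτ)
  rwa [(commute_map_rat g h).mul_mul_mul_comm, ← mul_assoc, eval_mul_map_rat,
    eval_mul_map_rat, hT1 τ hτ, mul_one, mul_one] at key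
end
end

section
/- Let R be either L or H, let S ⊆ R, let a ∈ ℤ, and let n ∈ ℤ with n ≠ 0. Then the following are equivalent: (i) S is a ringset of R; (ii) S+a is a ringset of R; (iii) nS is a ringset of R. -/
noncomputable section

open Polynomial

namespace Polynomial

variable {K A : Type*} [CommRing K] [Ring A] [Algebra K A]

theorem commute_C_map_algebraMap (p : K[X]) (a : A) :
    Commute (C a) (p.map (algebraMap K A)) := by
  ext n
  rw [coeff_C_mul, coeff_mul_C, coeff_map]
  exact (Algebra.commutes _ _).symm

theorem mul_comp_map_algebraMap (p : K[X]) (f g : A[X]) :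
    (f * g).comp (p.map (algebraMap K A)) =
      f.comp (p.map (algebraMap K A)) * g.comp (p.map (algebraMap K A)) :=
  map_mul (eval₂RingHom' C (p.map (algebraMap K A)) (commute_C_map_algebraMap p)) f g

theorem eval_comp_map_algebraMap (p : K[X]) (f : A[X]) (α : A) :
    (f.comp (p.map (algebraMap K A))).eval α = f.eval (aeval α p) := by
  induction f using Polynomial.induction_on' with
  | add f g hf hg => rw [add_comp, eval_add, hf, hg, eval_add]
  | monomial n a =>
    rw [monomial_comp, ← Polynomial.map_pow, eval_C_mul, eval_map_algebraMap, map_pow,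
      eval_monomial]

end Polynomial

theorem IsRingset.image_aeval {S R : Set 𝔻} (h : IsRingset S R) (p : ℚ[X]) :
    IsRingset ((fun α => aeval α p) '' S) R := by
  rintro f hf g hg _ ⟨α, hα, rfl⟩
  have pull : ∀ f ∈ IntPolys ((fun α => aeval α p) '' S) R,
      f.comp (p.map (algebraMap ℚ 𝔻)) ∈ IntPolys S R := fun f hf β hβ => by
    rw [eval_comp_map_algebraMap]
    exact hf _ ⟨β, hβ, rfl⟩
  have key := h _ (pull f hf) _ (pull g hg) α hα
  rwa [← mul_comp_map_algebraMap, eval_comp_map_algebraMap] at key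

theorem isRingset_iff_image_aeval {S R : Set 𝔻} (p q : ℚ[X])
    (hqp : ∀ α : 𝔻, aeval (aeval α p) q = α) :
    IsRingset S R ↔ IsRingset ((fun α => aeval α p) '' S) R := by
  refine ⟨fun h => h.image_aeval p, fun h => ?_⟩
  simpa [Set.image_image, hqp] using h.image_aeval q

/-- Ringset property is invariant under integer translation and nonzero integer scaling. -/
theorem stmt_5 (R : Set 𝔻) (hR : R = Lip ∨ R = Hur) (S : Set 𝔻) (hSsub : S ⊆ R)
    (a n : ℤ) (hn : n ≠ 0) :
    (IsRingset S R ↔ IsRingset (transSet S a) R) ∧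
    (IsRingset S R ↔ IsRingset (scaleSet n S) R) := by
  have : CharZero 𝔻 := algebraRat.charZero 𝔻
  have hn' : (n : 𝔻) ≠ 0 := Int.cast_ne_zero.mpr hn
  have htrans : transSet S a = (fun α => aeval α (X + C (a : ℚ))) '' S := by
    unfold transSet
    congr! 2
    simp
  have hscale : scaleSet n S = (fun α => aeval α (C (n : ℚ) * X)) '' S := by
    unfold scaleSet
    congr! 2
    simp
  rw [htrans, hscale]
  exact ⟨isRingset_iff_image_aeval _ (X - C (a : ℚ)) (by simp),
    isRingset_iff_image_aeval _ (C (n : ℚ)⁻¹ * X) (by simp [hn'])⟩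
end
end

section
/- Let S be a nonempty proper subset of the Lipschitz quaternions L with S ⊆ C_L(m) for some monic quadratic m ∈ ℤ[x]. Then S is reduced (with respect to L) if and only if for each prime p there exists β = b₀+b₁i+b₂j+b₃k ∈ S (bᵢ ∈ ℤ) such that p ∤ bᵢ for some 1 ≤ i ≤ 3. -/
noncomputable section

open Polynomial

theorem two_mul_re_of_mem_classOf {R : Set 𝔻} {m : Polynomial ℤ} (hm : m.Monic)
    (hdeg : m.natDegree = 2) {α : 𝔻} (hα : α ∈ classOf R m) :
    2 * α.re = -(m.coeff 1 : ℚ) := by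
  obtain ⟨-, h⟩ := hα
  have h2 : m.coeff 2 = 1 := hdeg ▸ hm.coeff_natDegree
  have c1 := congrArg (fun q => q.coeff 1) h
  have c2 := congrArg (fun q => q.coeff 2) h
  unfold minPoly at c1 c2
  split_ifs at c1 c2
  · simp [h2, coeff_X] at c2
  · simp only [coeff_add, coeff_sub, coeff_X_pow, coeff_C_mul, coeff_X, coeff_C, coeff_map,
      eq_intCast] at c1
    norm_num at c1
    linarith

theorem transSet_neg_re_subset_scaleSet {S : Set 𝔻} {r n : ℤ} (hre : ∀ β ∈ S, β.re = (r : ℚ))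
    (him : ∀ β ∈ S, ∃ c₁ c₂ c₃ : ℤ,
      β.imI = (n * c₁ : ℚ) ∧ β.imJ = (n * c₂ : ℚ) ∧ β.imK = (n * c₃ : ℚ)) :
    transSet S (-r) ⊆ scaleSet n Lip := by
  rintro _ ⟨β, hβ, rfl⟩
  obtain ⟨c₁, c₂, c₃, h₁, h₂, h₃⟩ := him β hβ
  obtain ⟨γ, g₀, g₁, g₂, g₃⟩ : ∃ γ : 𝔻, γ.re = 0 ∧ γ.imI = c₁ ∧ γ.imJ = c₂ ∧ γ.imK = c₃ :=
    ⟨⟨0, c₁, c₂, c₃⟩, rfl, rfl, rfl, rfl⟩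
  refine ⟨γ, ⟨⟨0, by simp [g₀]⟩, ⟨c₁, g₁⟩, ⟨c₂, g₂⟩, ⟨c₃, g₃⟩⟩, ?_⟩
  ext <;> simp [hre β hβ, h₁, h₂, h₃, g₀, g₁, g₂, g₃]

theorem exists_im_eq_mul_of_add_intCast_mem_scaleSet {β : 𝔻} {a n : ℤ}
    (h : β + (a : 𝔻) ∈ scaleSet n Lip) :
    ∃ c₁ c₂ c₃ : ℤ, β.imI = (n * c₁ : ℚ) ∧ β.imJ = (n * c₂ : ℚ) ∧ β.imK = (n * c₃ : ℚ) := by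
  obtain ⟨γ, ⟨-, ⟨c₁, h₁⟩, ⟨c₂, h₂⟩, ⟨c₃, h₃⟩⟩, hγ⟩ := h
  have e₁ := congrArg (fun q : 𝔻 => q.imI) hγ
  have e₂ := congrArg (fun q : 𝔻 => q.imJ) hγ
  have e₃ := congrArg (fun q : 𝔻 => q.imK) hγ
  simp [h₁, h₂, h₃] at e₁ e₂ e₃
  exact ⟨c₁, c₂, c₃, e₁.symm, e₂.symm, e₃.symm⟩

/-- Characterization of reduced subsets of the Lipschitz quaternions. -/
theorem stmt_6 (S : Set 𝔻) (hne : S.Nonempty) (hsub : S ⊂ Lip)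
    (m : Polynomial ℤ) (hm : m.Monic) (hdeg : m.natDegree = 2)
    (hcls : S ⊆ classOf Lip m) :
    IsReducedIn S Lip ↔
      ∀ p : ℕ, p.Prime →
        ∃ β ∈ S, ∃ b₁ b₂ b₃ : ℤ,
          β.imI = (b₁ : ℚ) ∧ β.imJ = (b₂ : ℚ) ∧ β.imK = (b₃ : ℚ) ∧
          (¬ (p : ℤ) ∣ b₁ ∨ ¬ (p : ℤ) ∣ b₂ ∨ ¬ (p : ℤ) ∣ b₃) := by
  constructor
  · rintro ⟨-, hred⟩ p hp
    by_contra! hdiv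
    obtain ⟨α, hα⟩ := hne
    obtain ⟨⟨⟨r, hr⟩, -⟩, -⟩ := hcls hα
    refine hred (-r) p (by exact_mod_cast hp.two_le)
      (transSet_neg_re_subset_scaleSet (fun β hβ => ?_) fun β hβ => ?_)
    · have h₁ := two_mul_re_of_mem_classOf hm hdeg (hcls hα)
      have h₂ := two_mul_re_of_mem_classOf hm hdeg (hcls hβ)
      linarith
    · obtain ⟨⟨-, ⟨b₁, h₁⟩, ⟨b₂, h₂⟩, ⟨b₃, h₃⟩⟩, -⟩ := hcls hβ
      obtain ⟨⟨c₁, rfl⟩, ⟨c₂, rfl⟩, ⟨c₃, rfl⟩⟩ := hdiv β hβ b₁ b₂ b₃ h₁ h₂ h₃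
      exact ⟨c₁, c₂, c₃, by exact_mod_cast h₁, by exact_mod_cast h₂, by exact_mod_cast h₃⟩
  · refine fun h => ⟨⟨m, hm, hdeg, hcls⟩, fun a n hn hsc => ?_⟩
    obtain ⟨p, hp, hpn⟩ := Nat.exists_prime_and_dvd (n := n.natAbs) (by omega)
    have hpn' : (p : ℤ) ∣ n := Int.natCast_dvd.mpr hpn
    obtain ⟨β, hβ, b₁, b₂, b₃, h₁, h₂, h₃, hb⟩ := h p hp
    obtain ⟨c₁, c₂, c₃, e₁, e₂, e₃⟩ :=
      exists_im_eq_mul_of_add_intCast_mem_scaleSet (hsc ⟨β, hβ, rfl⟩)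
    have d₁ : b₁ = n * c₁ := by exact_mod_cast h₁.symm.trans e₁
    have d₂ : b₂ = n * c₂ := by exact_mod_cast h₂.symm.trans e₂
    have d₃ : b₃ = n * c₃ := by exact_mod_cast h₃.symm.trans e₃
    subst d₁ d₂ d₃
    rcases hb with hb | hb | hb <;> exact hb (hpn'.mul_right _)
end
end

section
/- Let S be a nonempty proper subset of H∖L (the Hurwitz quaternions with all four coordinates in ℤ+1/2) with S ⊆ C_H(m) for some monic quadratic m ∈ ℤ[x]. Then S is reduced with respect to H if and only if for each odd prime p there exists β = (b₀+b₁i+b₂j+b₃k)/2 ∈ S (with b₀, b₁, b₂, b₃ odd integers) such that p ∤ bᵢ for some 1 ≤ i ≤ 3. -/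
noncomputable section

open Polynomial

theorem isHalfOddQ_ne_zero {q : ℚ} (h : isHalfOddQ q) : q ≠ 0 := by
  rintro rfl
  obtain ⟨z, hz⟩ := h
  have h2 : (2 * z + 1 : ℚ) = 0 := by linarith
  have h3 : 2 * z + 1 = 0 := by exact_mod_cast h2
  omega

theorem coeff_one_minPoly {α : 𝔻} (h : α.imI ≠ 0) : (minPoly α).coeff 1 = -(2 * α.re) := by
  rw [minPoly, if_neg (fun h' => h h'.1)]
  simp only [coeff_add, coeff_sub, coeff_X_pow, coeff_C_mul, coeff_X, coeff_C]
  norm_num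

theorem re_eq_of_minPoly_eq {α β : 𝔻} (hα : α.imI ≠ 0) (hβ : β.imI ≠ 0)
    (h : minPoly α = minPoly β) : α.re = β.re := by
  have h1 := congrArg (fun f => f.coeff 1) h
  simp only [coeff_one_minPoly hα, coeff_one_minPoly hβ] at h1
  linarith

/-- Every imaginary coefficient of a Hurwitz quaternion is half an integer. -/
theorem exists_im_eq_half_of_mem_Hur {α : 𝔻} (h : α ∈ Hur) :
    ∃ c₁ c₂ c₃ : ℤ, α.imI = (c₁ : ℚ) / 2 ∧ α.imJ = (c₂ : ℚ) / 2 ∧ α.imK = (c₃ : ℚ) / 2 := by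
  rcases h with ⟨-, ⟨x, hx⟩, ⟨y, hy⟩, ⟨z, hz⟩⟩ | ⟨-, ⟨x, hx⟩, ⟨y, hy⟩, ⟨z, hz⟩⟩
  · refine ⟨2 * x, 2 * y, 2 * z, ?_, ?_, ?_⟩ <;> push_cast <;> linarith
  · refine ⟨2 * x + 1, 2 * y + 1, 2 * z + 1, ?_, ?_, ?_⟩ <;> push_cast <;> linarith

theorem exists_isHalfOddQ_eq_mul_of_dvd {q : ℚ} {z p : ℤ} (hq : q = (z : ℚ) + 1 / 2)
    (hd : p ∣ 2 * z + 1) : ∃ r : ℚ, isHalfOddQ r ∧ q = p * r := by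
  obtain ⟨c, hc⟩ := hd
  have hodd : Odd (p * c) := hc ▸ odd_two_mul_add_one z
  obtain ⟨d, rfl⟩ := (Int.odd_mul.mp hodd).2
  refine ⟨d + 1 / 2, ⟨d, rfl⟩, ?_⟩
  have : (2 * z + 1 : ℚ) = p * (2 * d + 1) := by exact_mod_cast hc
  rw [hq]
  linarith

theorem dvd_of_half_eq_mul_half {b c n : ℤ} (h : (b : ℚ) / 2 = n * (c / 2)) : n ∣ b := by
  refine ⟨c, ?_⟩
  have : (b : ℚ) = n * c := by linarith
  exact_mod_cast this

/-- The doubled imaginary coefficients of an element of a set with `S + a ⊆ nH` are multiples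
of `n`. -/
theorem dvd_of_transSet_subset {S : Set 𝔻} {a n : ℤ} (h : transSet S a ⊆ scaleSet n Hur)
    {β : 𝔻} (hβ : β ∈ S) {b₁ b₂ b₃ : ℤ} (h₁ : β.imI = (b₁ : ℚ) / 2)
    (h₂ : β.imJ = (b₂ : ℚ) / 2) (h₃ : β.imK = (b₃ : ℚ) / 2) : n ∣ b₁ ∧ n ∣ b₂ ∧ n ∣ b₃ := by
  obtain ⟨γ, hγ, hγβ⟩ := h ⟨β, hβ, rfl⟩
  obtain ⟨c₁, c₂, c₃, e₁, e₂, e₃⟩ := exists_im_eq_half_of_mem_Hur hγ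
  have f₁ := congrArg (fun q : 𝔻 => q.imI) hγβ
  have f₂ := congrArg (fun q : 𝔻 => q.imJ) hγβ
  have f₃ := congrArg (fun q : 𝔻 => q.imK) hγβ
  simp at f₁ f₂ f₃
  rw [e₁, h₁] at f₁
  rw [e₂, h₂] at f₂
  rw [e₃, h₃] at f₃
  exact ⟨dvd_of_half_eq_mul_half f₁.symm, dvd_of_half_eq_mul_half f₂.symm,
    dvd_of_half_eq_mul_half f₃.symm⟩

/-- Characterization of reduced subsets of H lying in H∖L. -/
theorem stmt_7 (S : Set 𝔻) (hne : S.Nonempty) (hsub : S ⊂ HurOff)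
    (m : Polynomial ℤ) (hm : m.Monic) (hdeg : m.natDegree = 2)
    (hcls : S ⊆ classOf Hur m) :
    IsReducedIn S Hur ↔
      ∀ p : ℕ, p.Prime → p ≠ 2 →
        ∃ β ∈ S, ∃ b₁ b₂ b₃ : ℤ,
          β.imI = (b₁ : ℚ) / 2 ∧ β.imJ = (b₂ : ℚ) / 2 ∧ β.imK = (b₃ : ℚ) / 2 ∧
          (¬ (p : ℤ) ∣ b₁ ∨ ¬ (p : ℤ) ∣ b₂ ∨ ¬ (p : ℤ) ∣ b₃) := by
  constructor
  · rintro ⟨-, hred⟩ p hp hp2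
    by_contra! hcon
    have hpodd : Odd (p : ℤ) := by exact_mod_cast hp.odd_of_ne_two hp2
    obtain ⟨α, hα⟩ := hne
    obtain ⟨⟨r, hr⟩, hαI, -⟩ := hsub.1 hα
    obtain ⟨s, hs⟩ := hpodd
    refine hred (s - r) p (by exact_mod_cast hp.two_le) ?_
    rintro _ ⟨β, hβ, rfl⟩
    obtain ⟨-, ⟨x, hx⟩, ⟨y, hy⟩, ⟨z, hz⟩⟩ := hsub.1 hβ
    have hre : β.re = r + 1 / 2 := by
      rw [← hr]
      exact re_eq_of_minPoly_eq (isHalfOddQ_ne_zero ⟨x, hx⟩) (isHalfOddQ_ne_zero hαI)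
        ((hcls hβ).2.trans (hcls hα).2.symm)
    obtain ⟨d₁, d₂, d₃⟩ := hcon β hβ (2 * x + 1) (2 * y + 1) (2 * z + 1)
      (by rw [hx]; push_cast; ring) (by rw [hy]; push_cast; ring) (by rw [hz]; push_cast; ring)
    obtain ⟨u, hu, hxu⟩ := exists_isHalfOddQ_eq_mul_of_dvd hx d₁
    obtain ⟨v, hv, hyv⟩ := exists_isHalfOddQ_eq_mul_of_dvd hy d₂
    obtain ⟨w, hw, hzw⟩ := exists_isHalfOddQ_eq_mul_of_dvd hz d₃
    obtain ⟨γ, g₀, g₁, g₂, g₃⟩ : ∃ γ : 𝔻, γ.re = 1 / 2 ∧ γ.imI = u ∧ γ.imJ = v ∧ γ.imK = w :=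
      ⟨⟨1 / 2, u, v, w⟩, rfl, rfl, rfl, rfl⟩
    subst g₁ g₂ g₃
    refine ⟨γ, Or.inr ⟨⟨0, by simp [g₀]⟩, hu, hv, hw⟩, ?_⟩
    have hs' : (p : ℚ) = 2 * s + 1 := by exact_mod_cast hs
    ext
    · simp [hre, hs', g₀]
      ring
    · simp [hxu]
    · simp [hyv]
    · simp [hzw]
  · intro h
    refine ⟨⟨m, hm, hdeg, hcls⟩, fun a n hn hincl => ?_⟩
    obtain ⟨p, hp, hpn⟩ := Nat.exists_prime_and_dvd (n := n.natAbs) (by omega)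
    have hpn' : (p : ℤ) ∣ n := Int.natCast_dvd.mpr hpn
    by_cases hp2 : p = 2
    · obtain ⟨α, hα⟩ := hne
      obtain ⟨-, ⟨x, hx⟩, ⟨y, hy⟩, ⟨z, hz⟩⟩ := hsub.1 hα
      have hd := (dvd_of_transSet_subset hincl hα (b₁ := 2 * x + 1) (b₂ := 2 * y + 1)
        (b₃ := 2 * z + 1) (by rw [hx]; push_cast; ring) (by rw [hy]; push_cast; ring)
        (by rw [hz]; push_cast; ring)).1
      subst hp2
      have := hpn'.trans hd
      omega
    · obtain ⟨β, hβ, b₁, b₂, b₃, h₁, h₂, h₃, hnd⟩ := h p hp hp2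
      obtain ⟨d₁, d₂, d₃⟩ := dvd_of_transSet_subset hincl hβ h₁ h₂ h₃
      rcases hnd with hnd | hnd | hnd
      exacts [hnd (hpn'.trans d₁), hnd (hpn'.trans d₂), hnd (hpn'.trans d₃)]
end
end

section
/- Let S be a nonempty proper subset of the Lipschitz quaternions L with S ⊆ C_H(m) for some monic quadratic m ∈ ℤ[x]. Then S is reduced with respect to H if and only if both of the following hold: (i) S is reduced with respect to L, and (ii) there exists α ∈ S such that at least one imaginary coefficient of α is even. -/
noncomputable section

open Polynomial

theorem re_of_mem_classOf {R : Set 𝔻} {m : Polynomial ℤ} (hdeg : m.natDegree = 2) {α : 𝔻}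
    (h : α ∈ classOf R m) : 2 * α.re = -(m.coeff 1 : ℚ) := by
  have h2 := h.2
  unfold minPoly at h2
  split_ifs at h2 with h0
  · have := congrArg natDegree h2
    rw [natDegree_X_sub_C, natDegree_map_eq_of_injective (Int.castRingHom ℚ).injective_int,
      hdeg] at this
    omega
  · have := congrArg (fun p => p.coeff 1) h2
    simp only [coeff_add, coeff_sub, coeff_X_pow, coeff_C_mul, coeff_X_one, coeff_C,
      coeff_map, eq_intCast] at this
    norm_num at this
    linarith

theorem transSet_subset_scaleSet_iff {S R : Set 𝔻} {a n : ℤ} :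
    transSet S a ⊆ scaleSet n R ↔ ∀ α ∈ S, ∃ β ∈ R, (n : 𝔻) * β = α + (a : 𝔻) := by
  simp only [transSet, scaleSet, Set.image_subset_iff]
  rfl

theorem intCast_mul_eq_add_intCast_iff {a n : ℤ} {α β : 𝔻} :
    (n : 𝔻) * β = α + (a : 𝔻) ↔
      n * β.re = α.re + a ∧ n * β.imI = α.imI ∧ n * β.imJ = α.imJ ∧ n * β.imK = α.imK := by
  rw [Quaternion.ext_iff]
  simp

theorem isIntQ_two_mul_of_isHalfOddQ {q : ℚ} (h : isHalfOddQ q) : isIntQ (((2 : ℤ) : ℚ) * q) := by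
  obtain ⟨z, rfl⟩ := h
  exact ⟨2 * z + 1, by push_cast; ring⟩

theorem isIntQ_two_mul {q : ℚ} (h : isIntQ q) : isIntQ (((2 : ℤ) : ℚ) * q) := by
  obtain ⟨z, rfl⟩ := h
  exact ⟨2 * z, by push_cast; ring⟩

theorem two_mul_mem_Lip {β : 𝔻} (h : β ∈ Hur) : ((2 : ℤ) : 𝔻) * β ∈ Lip := by
  rcases h with ⟨h0, h1, h2, h3⟩ | ⟨h0, h1, h2, h3⟩
  · refine ⟨?_, ?_, ?_, ?_⟩ <;> simpa [-Int.cast_ofNat] using isIntQ_two_mul ‹_›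
  · refine ⟨?_, ?_, ?_, ?_⟩ <;> simpa [-Int.cast_ofNat] using isIntQ_two_mul_of_isHalfOddQ ‹_›

theorem not_isHalfOddQ_of_isIntQ_odd_mul {n : ℤ} (hn : Odd n) {q : ℚ} (h : isIntQ (n * q)) :
    ¬ isHalfOddQ q := by
  rintro ⟨z, rfl⟩
  obtain ⟨w, hw⟩ := h
  have h2 : n * (2 * z + 1) = 2 * w := by
    have : (n : ℚ) * (2 * z + 1) = 2 * w := by linarith
    exact_mod_cast this
  have hodd : Odd (n * (2 * z + 1)) := hn.mul ⟨z, rfl⟩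
  rw [h2] at hodd
  exact Int.not_odd_iff_even.2 ⟨w, by ring⟩ hodd

theorem not_isHalfOddQ_of_two_mul_even {q : ℚ} {b : ℤ} (h : 2 * q = ((2 * b : ℤ) : ℚ)) :
    ¬ isHalfOddQ q := by
  push_cast at h
  obtain rfl : q = b := by linarith
  exact not_isHalfOddQ_of_isIntQ_odd_mul odd_one ⟨b, by simp⟩

theorem isHalfOddQ_half_of_not_even {q : ℚ} (hq : isIntQ q)
    (h : ¬ ∃ b : ℤ, q = ((2 * b : ℤ) : ℚ)) : isHalfOddQ (q / 2) := by
  obtain ⟨z, rfl⟩ := hq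
  obtain ⟨b, rfl | rfl⟩ := Int.even_or_odd' z
  · exact absurd ⟨b, rfl⟩ h
  · exact ⟨b, by push_cast; ring⟩

theorem mem_Lip_of_mem_Hur_of_re {β : 𝔻} (h : β ∈ Hur) (h0 : ¬ isHalfOddQ β.re) : β ∈ Lip :=
  h.resolve_right fun h' => h0 h'.1

/-- If `S` lies in a quadratic class and all imaginary coefficients of its elements are odd, then
some integer translate of `S` lies in `2 Hur`. -/
theorem exists_transSet_subset_two_scaleSet_Hur {S : Set 𝔻} (hne : S.Nonempty) (hS : S ⊆ Lip)
    (hre : ∀ α ∈ S, ∀ β ∈ S, α.re = β.re)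
    (hodd : ∀ α ∈ S, isHalfOddQ (α.imI / 2) ∧ isHalfOddQ (α.imJ / 2) ∧ isHalfOddQ (α.imK / 2)) :
    ∃ a : ℤ, transSet S a ⊆ scaleSet 2 Hur := by
  obtain ⟨α₀, hα₀⟩ := hne
  obtain ⟨r, hr⟩ := (hS hα₀).1
  refine ⟨1 - r, transSet_subset_scaleSet_iff.2 fun α hα => ?_⟩
  obtain ⟨h1, h2, h3⟩ := hodd α hα
  refine ⟨⟨1 / 2, α.imI / 2, α.imJ / 2, α.imK / 2⟩, Or.inr ⟨⟨0, by simp⟩, h1, h2, h3⟩, ?_⟩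
  refine intCast_mul_eq_add_intCast_iff.2 ?_
  rw [hre α hα α₀ hα₀, hr]
  refine ⟨?_, ?_, ?_, ?_⟩ <;> push_cast <;> ring

/-- If a translate of `S ⊆ Lip` lies in `n Hur`, then a translate lies in `k Lip` for some
`k ≥ 2`, provided `S` has constant real part and an element with an even imaginary coefficient. -/
theorem exists_transSet_subset_scaleSet_Lip {S : Set 𝔻} (hS : S ⊆ Lip)
    (hre : ∀ α ∈ S, ∀ β ∈ S, α.re = β.re)
    (heven : ∃ α ∈ S, ((∃ b : ℤ, α.imI = ((2 * b : ℤ) : ℚ)) ∨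
      (∃ b : ℤ, α.imJ = ((2 * b : ℤ) : ℚ)) ∨ (∃ b : ℤ, α.imK = ((2 * b : ℤ) : ℚ))))
    {a n : ℤ} (hn : 2 ≤ n) (h : transSet S a ⊆ scaleSet n Hur) :
    ∃ k : ℤ, 2 ≤ k ∧ transSet S a ⊆ scaleSet k Lip := by
  simp only [transSet_subset_scaleSet_iff] at h ⊢
  obtain ⟨k, rfl | rfl⟩ := Int.even_or_odd' n
  · rcases eq_or_ne k 1 with rfl | hk
    · refine ⟨2, le_rfl, fun γ hγ => ?_⟩
      obtain ⟨α, hα, hα'⟩ := heven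
      obtain ⟨β, hβ, hβα⟩ := h α hα
      obtain ⟨δ, hδ, hδγ⟩ := h γ hγ
      rw [mul_one] at hβα hδγ
      obtain ⟨e0, e1, e2, e3⟩ := intCast_mul_eq_add_intCast_iff.1 hβα
      refine ⟨δ, mem_Lip_of_mem_Hur_of_re hδ ?_, hδγ⟩
      have hδβ : δ.re = β.re := by
        have := (intCast_mul_eq_add_intCast_iff.1 hδγ).1
        rw [hre γ hγ α hα] at this
        push_cast at this e0
        linarith
      have hβL : β ∈ Lip := hβ.resolve_right fun ⟨_, h1, h2, h3⟩ => by
        rcases hα' with ⟨b, hb⟩ | ⟨b, hb⟩ | ⟨b, hb⟩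
        · exact not_isHalfOddQ_of_two_mul_even (e1.trans hb) h1
        · exact not_isHalfOddQ_of_two_mul_even (e2.trans hb) h2
        · exact not_isHalfOddQ_of_two_mul_even (e3.trans hb) h3
      rw [hδβ]
      obtain ⟨z, hz⟩ := hβL.1
      exact not_isHalfOddQ_of_isIntQ_odd_mul odd_one ⟨z, by simp [hz]⟩
    · refine ⟨k, by omega, fun α hα => ?_⟩
      obtain ⟨β, hβ, hβα⟩ := h α hα
      refine ⟨_, two_mul_mem_Lip hβ, ?_⟩
      rw [← hβα, ← mul_assoc, ← Int.cast_mul, mul_comm k]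
  · refine ⟨2 * k + 1, hn, fun α hα => ?_⟩
    obtain ⟨β, hβ, hβα⟩ := h α hα
    refine ⟨β, mem_Lip_of_mem_Hur_of_re hβ (not_isHalfOddQ_of_isIntQ_odd_mul ⟨k, rfl⟩ ?_), hβα⟩
    obtain ⟨z, hz⟩ := (hS hα).1
    exact ⟨z + a, by rw [(intCast_mul_eq_add_intCast_iff.1 hβα).1, hz]; push_cast; rfl⟩

/-- Characterization of subsets of L that are reduced with respect to H. -/
theorem stmt_8 (S : Set 𝔻) (hne : S.Nonempty) (hsub : S ⊂ Lip)
    (m : Polynomial ℤ) (hm : m.Monic) (hdeg : m.natDegree = 2)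
    (hcls : S ⊆ classOf Hur m) :
    IsReducedIn S Hur ↔
      (IsReducedIn S Lip ∧
        ∃ α ∈ S,
          ((∃ b : ℤ, α.imI = ((2 * b : ℤ) : ℚ)) ∨
           (∃ b : ℤ, α.imJ = ((2 * b : ℤ) : ℚ)) ∨
           (∃ b : ℤ, α.imK = ((2 * b : ℤ) : ℚ)))) := by
  have hS : S ⊆ Lip := hsub.subset
  have hre : ∀ α ∈ S, ∀ β ∈ S, α.re = β.re := fun α hα β hβ => by
    have h1 := re_of_mem_classOf hdeg (hcls hα)
    have h2 := re_of_mem_classOf hdeg (hcls hβ)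
    linarith
  constructor
  · rintro ⟨-, hred⟩
    refine ⟨⟨⟨m, hm, hdeg, fun α hα => ⟨hS hα, (hcls hα).2⟩⟩, fun a n hn h =>
      hred a n hn (h.trans (Set.image_mono Lip_subset_Hur))⟩, ?_⟩
    by_contra hcon
    obtain ⟨a, ha⟩ := exists_transSet_subset_two_scaleSet_Hur hne hS hre fun α hα => by
      obtain ⟨-, h1, h2, h3⟩ := hS hα
      exact ⟨isHalfOddQ_half_of_not_even h1 fun h => hcon ⟨α, hα, Or.inl h⟩,
        isHalfOddQ_half_of_not_even h2 fun h => hcon ⟨α, hα, Or.inr (Or.inl h)⟩,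
        isHalfOddQ_half_of_not_even h3 fun h => hcon ⟨α, hα, Or.inr (Or.inr h)⟩⟩
    exact hred a 2 le_rfl ha
  · rintro ⟨⟨-, hred⟩, heven⟩
    refine ⟨⟨m, hm, hdeg, hcls⟩, fun a n hn h => ?_⟩
    obtain ⟨k, hk, hsub'⟩ := exists_transSet_subset_scaleSet_Lip hS hre heven hn h
    exact hred a k hk hsub'
end
end

section
/- Let R be either L or H, and let S be a nonempty proper subset of R with S ⊆ C_R(m) for some monic quadratic m ∈ ℤ[x]. Then there exist a reduced set T ⊊ R and integers a, n with n ≥ 1 such that S = a + nT := {a + nτ : τ ∈ T}. Moreover, S is a ringset of R if and only if T is a ringset of R. -/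
noncomputable section

open Polynomial

/-- Substitution of the central linear polynomial `r + qX`. -/
def linearSubst (r q : ℚ) : 𝔻[X] →+* 𝔻[X] :=
  eval₂RingHom' C (C (r : 𝔻) + C (q : 𝔻) * X) fun a => by
    have hr : Commute (C a) (C (r : 𝔻)) := (Rat.commute_cast a r).map C
    have hq : Commute (C a) (C (q : 𝔻)) := (Rat.commute_cast a q).map C
    exact hr.add_right (hq.mul_right (commute_X _).symm)

theorem eval_linearSubst (r q : ℚ) (f : 𝔻[X]) (α : 𝔻) :
    (linearSubst r q f).eval α = f.eval ((r : 𝔻) + (q : 𝔻) * α) := by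
  have hpow (k : ℕ) : ((C (r : 𝔻) + C (q : 𝔻) * X) ^ k).eval α =
      ((r : 𝔻) + (q : 𝔻) * α) ^ k := by
    induction k with
    | zero => simp
    | succ k ih =>
      rw [pow_succ', add_mul, mul_assoc, X_mul, eval_add, eval_C_mul, eval_C_mul, eval_mul_X, ih,
        pow_succ', add_mul, mul_assoc]
      congr 2
      have h : Commute α ((r : 𝔻) + (q : 𝔻) * α) :=
        (Rat.commute_cast α r).add_right ((Rat.commute_cast α q).mul_right (Commute.refl α))
      exact (h.pow_right k).eq.symm
  induction f using Polynomial.induction_on' with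
  | add f g hf hg => rw [map_add, eval_add, eval_add, hf, hg]
  | monomial k c =>
    have : linearSubst r q (monomial k c) = C c * (C (r : 𝔻) + C (q : 𝔻) * X) ^ k :=
      eval₂_monomial _ _
    rw [this, eval_C_mul, hpow, eval_monomial]

theorem IsRingset.image_linear {S R : Set 𝔻} (h : IsRingset S R) (r q : ℚ) :
    IsRingset ((fun α => (r : 𝔻) + (q : 𝔻) * α) '' S) R := by
  have key (f : 𝔻[X]) : f ∈ IntPolys ((fun α => (r : 𝔻) + (q : 𝔻) * α) '' S) R ↔
      linearSubst r q f ∈ IntPolys S R := by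
    simp [IntPolys, eval_linearSubst]
  intro f hf g hg
  rw [key, map_mul]
  exact h _ ((key f).1 hf) _ ((key g).1 hg)

theorem exists_int_of_mem_Lip_or_Hur {R : Set 𝔻} (hR : R = Lip ∨ R = Hur) {α : 𝔻} (hα : α ∈ R) :
    isIntQ (2 * α.re) ∧ isIntQ (2 * α.imI) ∧ isIntQ (2 * α.imJ) ∧ isIntQ (2 * α.imK) ∧
      isIntQ (qnorm α) := by
  have h : α ∈ Lip ∨ α ∈ HurOff := by
    rcases hR with rfl | rfl
    · exact Or.inl hα
    · exact hα
  rcases h with ⟨⟨a, ha⟩, ⟨b, hb⟩, ⟨c, hc⟩, ⟨d, hd⟩⟩ | ⟨⟨a, ha⟩, ⟨b, hb⟩, ⟨c, hc⟩, ⟨d, hd⟩⟩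
  · refine ⟨⟨2 * a, ?_⟩, ⟨2 * b, ?_⟩, ⟨2 * c, ?_⟩, ⟨2 * d, ?_⟩,
      ⟨a ^ 2 + b ^ 2 + c ^ 2 + d ^ 2, ?_⟩⟩ <;> simp [qnorm, ha, hb, hc, hd]
  · refine ⟨⟨2 * a + 1, ?_⟩, ⟨2 * b + 1, ?_⟩, ⟨2 * c + 1, ?_⟩, ⟨2 * d + 1, ?_⟩,
      ⟨a ^ 2 + a + b ^ 2 + b + c ^ 2 + c + d ^ 2 + d + 1, ?_⟩⟩ <;>
    · simp only [qnorm, ha, hb, hc, hd]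
      push_cast
      ring

theorem zero_mem_of_Lip_or_Hur {R : Set 𝔻} (hR : R = Lip ∨ R = Hur) : (0 : 𝔻) ∈ R := by
  have h : (0 : 𝔻) ∈ Lip := ⟨⟨0, rfl⟩, ⟨0, rfl⟩, ⟨0, rfl⟩, ⟨0, rfl⟩⟩
  rcases hR with rfl | rfl
  · exact h
  · exact Or.inl h

theorem nonreal_of_minPoly_eq {α : 𝔻} {m : ℤ[X]} (hm : m.Monic) (hdeg : m.natDegree = 2)
    (h : minPoly α = m.map (Int.castRingHom ℚ)) :
    ¬ (α.imI = 0 ∧ α.imJ = 0 ∧ α.imK = 0) ∧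
      2 * α.re = -(m.coeff 1 : ℚ) ∧ qnorm α = m.coeff 0 := by
  have hα : ¬ (α.imI = 0 ∧ α.imJ = 0 ∧ α.imK = 0) := by
    intro hreal
    have := congrArg natDegree h
    rw [hm.natDegree_map, hdeg, minPoly, if_pos hreal, natDegree_X_sub_C] at this
    omega
  rw [minPoly, if_neg hα] at h
  have h1 := congrArg (fun p => coeff p 1) h
  have h0 := congrArg (fun p => coeff p 0) h
  simp [coeff_X, coeff_C, coeff_X_pow] at h1 h0
  exact ⟨hα, by linarith, h0⟩

theorem le_abs_two_mul_of_eq {n : ℤ} {x y : ℚ} (hx : isIntQ (2 * x))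
    (hy : isIntQ (2 * y)) (h : x = n * y) (hx0 : x ≠ 0) : (n : ℚ) ≤ |2 * x| := by
  obtain ⟨u, hu⟩ := hx
  obtain ⟨v, hv⟩ := hy
  have huv : u = n * v := by
    have : (u : ℚ) = n * v := by rw [← hu, ← hv, h]; ring
    exact_mod_cast this
  have hu0 : u ≠ 0 := by
    rintro rfl
    apply hx0
    simpa using hu
  rw [hu]
  have := Int.le_of_dvd (abs_pos.2 hu0) ((dvd_abs n u).2 ⟨v, huv⟩)
  exact_mod_cast this

/-- A dilation factor of a nonreal element is bounded by its imaginary coefficients. -/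
theorem bddAbove_scale {R : Set 𝔻} (hR : R = Lip ∨ R = Hur) {α : 𝔻} (hα : α ∈ R)
    (hnr : ¬ (α.imI = 0 ∧ α.imJ = 0 ∧ α.imK = 0)) :
    ∃ b : ℤ, ∀ n a : ℤ, α + (a : 𝔻) ∈ scaleSet n R → n ≤ b := by
  obtain ⟨b, hb⟩ := exists_int_gt (|2 * α.imI| + |2 * α.imJ| + |2 * α.imK|)
  refine ⟨b, fun n a => ?_⟩
  rintro ⟨β, hβ, h⟩
  obtain ⟨-, αI, αJ, αK, -⟩ := exists_int_of_mem_Lip_or_Hur hR hα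
  obtain ⟨-, βI, βJ, βK, -⟩ := exists_int_of_mem_Lip_or_Hur hR hβ
  have hI : α.imI = n * β.imI := by simpa using (congrArg QuaternionAlgebra.imI h).symm
  have hJ : α.imJ = n * β.imJ := by simpa using (congrArg QuaternionAlgebra.imJ h).symm
  have hK : α.imK = n * β.imK := by simpa using (congrArg QuaternionAlgebra.imK h).symm
  have pI := abs_nonneg (2 * α.imI)
  have pJ := abs_nonneg (2 * α.imJ)
  have pK := abs_nonneg (2 * α.imK)
  have hle : (n : ℚ) ≤ b := by
    by_cases h1 : α.imI = 0
    · by_cases h2 : α.imJ = 0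
      · have := le_abs_two_mul_of_eq αK βK hK fun h3 => hnr ⟨h1, h2, h3⟩
        linarith
      · have := le_abs_two_mul_of_eq αJ βJ hJ h2
        linarith
    · have := le_abs_two_mul_of_eq αI βI hI h1
      linarith
  exact_mod_cast hle

/-- Every nonempty subset of a minimal polynomial class has an associated reduced set. -/
theorem stmt_9 (R : Set 𝔻) (hR : R = Lip ∨ R = Hur)
    (S : Set 𝔻) (hne : S.Nonempty) (hsub : S ⊂ R)
    (m : Polynomial ℤ) (hm : m.Monic) (hdeg : m.natDegree = 2)
    (hcls : S ⊆ classOf R m) :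
    ∃ T : Set 𝔻, ∃ a n : ℤ, T ⊂ R ∧ IsReducedIn T R ∧ 1 ≤ n ∧
      S = (fun τ => (a : 𝔻) + (n : 𝔻) * τ) '' T ∧
      (IsRingset S R ↔ IsRingset T R) := by
  have hS (α : 𝔻) (hα : α ∈ S) := nonreal_of_minPoly_eq hm hdeg (hcls hα).2
  obtain ⟨α₀, hα₀⟩ := hne
  obtain ⟨b, hb⟩ := bddAbove_scale hR (hsub.1 hα₀) (hS α₀ hα₀).1
  obtain ⟨n, ⟨hn, a, hna⟩, hmax⟩ := Int.exists_greatest_of_bdd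
    (P := fun n => 1 ≤ n ∧ ∃ a : ℤ, transSet S a ⊆ scaleSet n R)
    ⟨b, fun n ⟨_, a, h⟩ => hb n a (h ⟨α₀, hα₀, rfl⟩)⟩
    ⟨1, le_rfl, 0, by
      rintro _ ⟨α, hα, rfl⟩
      exact ⟨α, hsub.1 hα, by simp⟩⟩
  have : CharZero 𝔻 := algebraRat.charZero 𝔻
  have hn0 : (n : 𝔻) ≠ 0 := by exact_mod_cast (by omega : n ≠ 0)
  have hnq : (n : ℚ) ≠ 0 := by exact_mod_cast (by omega : n ≠ 0)
  set T : Set 𝔻 := {τ | τ ∈ R ∧ ((-a : ℤ) : 𝔻) + (n : 𝔻) * τ ∈ S}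
  have hST : S = (fun τ => ((-a : ℤ) : 𝔻) + (n : 𝔻) * τ) '' T := by
    ext α
    constructor
    · intro hα
      obtain ⟨τ, hτ, h⟩ := hna ⟨α, hα, rfl⟩
      have h' : ((-a : ℤ) : 𝔻) + (n : 𝔻) * τ = α := by
        simp only at h
        rw [h]
        push_cast
        abel
      exact ⟨τ, ⟨hτ, h'.symm ▸ hα⟩, h'⟩
    · rintro ⟨τ, hτ, rfl⟩
      exact hτ.2
  have hTS : T = (fun α => ((a / n : ℚ) : 𝔻) + ((1 / n : ℚ) : 𝔻) * α) '' S := by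
    have hinv (τ : 𝔻) : ((a / n : ℚ) : 𝔻) + ((1 / n : ℚ) : 𝔻) *
        (((-a : ℤ) : 𝔻) + (n : 𝔻) * τ) = τ := by
      push_cast
      rw [mul_add, ← mul_assoc, one_div, inv_mul_cancel₀ hn0, div_eq_mul_inv, one_mul, mul_neg,
        (Int.cast_commute a ((n : 𝔻)⁻¹)).eq]
      abel
    conv_rhs => rw [hST, Set.image_image]
    simp only [hinv, Set.image_id']
  have hre (τ : 𝔻) (hτ : τ ∈ T) : ¬ (τ.imI = 0 ∧ τ.imJ = 0 ∧ τ.imK = 0) ∧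
      n * (2 * τ.re) = 2 * a - m.coeff 1 ∧
      n ^ 2 * qnorm τ = m.coeff 0 - a * m.coeff 1 + a ^ 2 := by
    obtain ⟨h1, h2, h3⟩ := hS _ hτ.2
    simp [qnorm] at h1 h2 h3
    refine ⟨fun ⟨x, y, z⟩ => ?_, by linarith, ?_⟩
    · simp [x, y, z] at h1
    · rw [qnorm]
      linear_combination h3 + a * h2
  obtain ⟨τ₀, hτ₀, -⟩ : ∃ τ ∈ T, ((-a : ℤ) : 𝔻) + (n : 𝔻) * τ = α₀ := by
    have := hα₀
    rw [hST] at this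
    exact this
  obtain ⟨⟨t, ht⟩, -, -, -, ⟨N, hN⟩⟩ := exists_int_of_mem_Lip_or_Hur hR hτ₀.1
  refine ⟨T, -a, n, ⟨fun τ hτ => hτ.1, fun h => ?_⟩, ⟨⟨X ^ 2 - C t * X + C N, ?_, ?_, ?_⟩, ?_⟩,
    hn, hST, ⟨fun h => ?_, fun h => ?_⟩⟩
  · exact (hre 0 (h (zero_mem_of_Lip_or_Hur hR))).1 ⟨rfl, rfl, rfl⟩
  · monicity!
  · compute_degree!
  · intro τ hτ
    refine ⟨hτ.1, ?_⟩
    obtain ⟨h1, h2, h3⟩ := hre τ hτ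
    obtain ⟨-, k2, k3⟩ := hre τ₀ hτ₀
    have e2 : 2 * τ.re = t := by
      rw [← ht]
      exact mul_left_cancel₀ hnq (h2.trans k2.symm)
    have e3 : qnorm τ = N := by
      rw [← hN]
      exact mul_left_cancel₀ (pow_ne_zero 2 hnq) (h3.trans k3.symm)
    rw [minPoly, if_neg h1, e2, e3]
    simp
  · intro c k hk hsubset
    have hle := hmax (n * k) ⟨by nlinarith, a + n * c, by
      rintro _ ⟨α, hα, rfl⟩
      rw [hST] at hα
      obtain ⟨τ, hτ, rfl⟩ := hα
      obtain ⟨β, hβ, h⟩ := hsubset ⟨τ, hτ, rfl⟩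
      refine ⟨β, hβ, ?_⟩
      simp only at h ⊢
      push_cast
      rw [mul_assoc, h, mul_add]
      abel⟩
    nlinarith
  · rw [hTS]
    exact h.image_linear _ _
  · rw [hST]
    simpa using h.image_linear (-a : ℚ) (n : ℚ)
end
end
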